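/- The quotient P(V_{2,4})/(SL₂(ℂ)×SL₂(ℂ)) is rational: the field of SL₂×SL₂-invariant rational functions on the 14-dimensional projective space P(V_{2,4}) of bidegree (2,4) biforms is a purely transcendental extension of ℂ of transcendence degree 8. -/

import Mathlib

set_option synthInstance.maxHeartbeats 1000000
set_option maxHeartbeats 1000000
noncomputable section
open MvPolynomial

/-- The field of invariant rational functions: the subfield of the fraction field of `R`
consisting of elements fixed by a family of `ℂ`-algebra endomorphisms of `R`. -/
def invariantField (R : Type*) [CommRing R] [IsDomain R] [Algebra ℂ R]
    {ι : Type*} (φ : ι → (R →ₐ[ℂ] R)) : IntermediateField ℂ (FractionRing R) where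
  carrier := {x | ∃ f g : R, g ≠ 0 ∧
      x = algebraMap R (FractionRing R) f / algebraMap R (FractionRing R) g ∧
      ∀ i, φ i f * g = φ i g * f}
  mul_mem' := by
    rintro x y ⟨f, g, hg, rfl, hf⟩ ⟨p, q, hq, rfl, hp⟩
    exact ⟨f * p, g * q, mul_ne_zero hg hq,
      by rw [map_mul, map_mul, div_mul_div_comm],
      fun i => by
        simp only [map_mul]
        linear_combination (φ i p * q) * hf i + (φ i g * f) * hp i⟩
  one_mem' := ⟨1, 1, one_ne_zero, by simp, fun i => rfl⟩
  add_mem' := by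
    rintro x y ⟨f, g, hg, rfl, hf⟩ ⟨p, q, hq, rfl, hp⟩
    have hg' : algebraMap R (FractionRing R) g ≠ 0 :=
      fun h => hg ((map_eq_zero_iff _ (IsFractionRing.injective R (FractionRing R))).mp h)
    have hq' : algebraMap R (FractionRing R) q ≠ 0 :=
      fun h => hq ((map_eq_zero_iff _ (IsFractionRing.injective R (FractionRing R))).mp h)
    refine ⟨f * q + g * p, g * q, mul_ne_zero hg hq, ?_, fun i => ?_⟩
    · rw [map_add, map_mul, map_mul, map_mul, div_add_div _ _ hg' hq']
    · simp only [map_add, map_mul]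
      linear_combination (φ i q * q) * hf i + (φ i g * g) * hp i
  zero_mem' := ⟨0, 1, one_ne_zero, by simp, fun i => by simp⟩
  algebraMap_mem' := fun c =>
    ⟨algebraMap ℂ R c, 1, one_ne_zero,
      by rw [map_one, div_one, ← IsScalarTower.algebraMap_apply],
      fun i => by simp [AlgHom.commutes]⟩
  inv_mem' := by
    rintro x ⟨f, g, hg, rfl, hf⟩
    by_cases hf0 : f = 0
    · exact ⟨0, 1, one_ne_zero, by simp [hf0], fun i => by simp⟩
    · exact ⟨g, f, hf0, by rw [inv_div], fun i => (hf i).symm⟩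

abbrev SL2 := Matrix.SpecialLinearGroup (Fin 2) ℂ

/-- The action of `SL₂(ℂ)` on binary forms by linear substitution of the variables. -/
def sub1 (g : SL2) : MvPolynomial (Fin 2) ℂ →ₐ[ℂ] MvPolynomial (Fin 2) ℂ :=
  aeval fun i => ∑ j, C (g.1 i j) * X j

/-- The matrix of the action of `g` on `V_d` in the basis of monomials `X^i Y^(d-i)`. -/
def repMat (d : ℕ) (g : SL2) (i j : Fin (d + 1)) : ℂ :=
  coeff (Finsupp.single 0 (i : ℕ) + Finsupp.single 1 (d - (i : ℕ)))
    (sub1 g (X 0 ^ (j : ℕ) * X 1 ^ (d - (j : ℕ))))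

/-- The endomorphism of the coordinate ring of `V_{a,b} = V_a ⊗ V_b` induced by
`(g, h) ∈ SL₂ × SL₂` together with the scaling by `t` (so that invariance under the
scalings expresses that a rational function descends to the projectivization). -/
def coordHomAB (a b : ℕ) (g h : SL2) (t : ℂˣ) :
    MvPolynomial (Fin (a + 1) × Fin (b + 1)) ℂ →ₐ[ℂ]
      MvPolynomial (Fin (a + 1) × Fin (b + 1)) ℂ :=
  aeval fun p => (t : ℂ) • ∑ q, C (repMat a g p.1 q.1 * repMat b h p.2 q.2) * X q

/-- The field `ℂ(P(V_{a,b}))^{SL₂×SL₂}` of `SL₂(ℂ) × SL₂(ℂ)`-invariant rational functions on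
the projective space of biforms of bidegree `(a,b)`, realized as the field of rational
functions in the coefficient coordinates (indexed by `Fin (a+1) × Fin (b+1)`) that are
invariant under the induced linear action and under scaling. -/
def invFieldAB (a b : ℕ) :
    IntermediateField ℂ (FractionRing (MvPolynomial (Fin (a + 1) × Fin (b + 1)) ℂ)) :=
  invariantField _ fun γ : SL2 × SL2 × ℂˣ => coordHomAB a b γ.1 γ.2.1 γ.2.2



abbrev M3 (k : Type*) := Matrix (Fin 3) (Fin 3) k

section core
variable {k : Type*} [CommRing k]

def qax (N : M3 k) : Fin 3 → k := ![N 1 2 - N 2 1, N 2 0 - N 0 2, N 0 1 - N 1 0]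
def qcr (x y : Fin 3 → k) : Fin 3 → k :=
  ![x 1 * y 2 - x 2 * y 1, x 2 * y 0 - x 0 * y 2, x 0 * y 1 - x 1 * y 0]
def qcrs (m : M3 k) : M3 k := Matrix.of ![qcr (m 1) (m 2), qcr (m 2) (m 0), qcr (m 0) (m 1)]
def qmix (C : M3 k) (S : Fin 3 → M3 k) : Fin 3 → M3 k := fun i => ∑ j, C i j • S j
def qconj (R : M3 k) (S : Fin 3 → M3 k) : Fin 3 → M3 k := fun i => R * S i * R.transpose
def qtri (S : Fin 3 → M3 k) (b : M3 k) : Fin 3 → k := ∑ i, (S i).mulVec (b i)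
def qbrk (S : Fin 3 → M3 k) : M3 k :=
  Matrix.of ![qax (S 1 * S 2), qax (S 2 * S 0), qax (S 0 * S 1)]
def qe (S : Fin 3 → M3 k) : Fin 3 → k := qtri S (qbrk S)
def qm (S : Fin 3 → M3 k) : M3 k := Matrix.of fun i => (S i).mulVec (qe S)
def qc (S : Fin 3 → M3 k) : M3 k := qcrs (qm S)
def qd (S : Fin 3 → M3 k) : Fin 3 → k := qtri S (qc S)
def qz (S : Fin 3 → M3 k) (w : Fin 3 → k) : M3 k := ∑ i, (qc S i ⬝ᵥ w) • S i
def qh (S : Fin 3 → M3 k) : Fin 3 → k := qcr (qe S) (qd S)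
def qg (S : Fin 3 → M3 k) : Fin 3 → k := qcr (qh S) (qe S)
def qbil (N : M3 k) (x y : Fin 3 → k) : k := x ⬝ᵥ N.mulVec y
def qM (S : Fin 3 → M3 k) : M3 k := (qm S).transpose * qm S
def qeps (S : Fin 3 → M3 k) : k := qe S ⬝ᵥ qe S
def qH (S : Fin 3 → M3 k) : k := qh S ⬝ᵥ qh S
def qdel (S : Fin 3 → M3 k) : k := (qm S).det
def qq1 (S : Fin 3 → M3 k) : k := qbil (qz S (qe S)) (qh S) (qh S)
def qq2 (S : Fin 3 → M3 k) : k := qbil (qz S (qe S)) (qh S) (qg S)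
def qq3 (S : Fin 3 → M3 k) : k := qbil (qz S (qh S)) (qh S) (qh S)
def qMee (S : Fin 3 → M3 k) : k := qbil (qM S) (qe S) (qe S)

def qnum (S : Fin 3 → M3 k) : Fin 8 → k :=
  ![qq1 S, qq2 S ^ 2, qeps S * qq3 S ^ 2, qeps S * qbil (qM S) (qh S) (qh S),
    qbil (qM S) (qg S) (qg S), qbil (qM S) (qe S) (qh S) * qq3 S * qeps S,
    qbil (qM S) (qh S) (qg S) * qq2 S, qbil (qM S) (qe S) (qg S) * qq2 S * qq3 S]
def qden (S : Fin 3 → M3 k) : Fin 8 → k :=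
  ![qdel S * qH S, qdel S ^ 2 * qH S ^ 2 * qeps S, qdel S ^ 2 * qH S ^ 3, qH S * qMee S,
    qH S * qMee S, qdel S * qH S ^ 2 * qMee S, qdel S * qH S ^ 2 * qMee S,
    qdel S ^ 2 * qH S ^ 3 * qMee S]
def qnd (S : Fin 3 → M3 k) : k :=
  qeps S * qH S * qdel S * qq2 S * qq3 S * qMee S * (qq1 S + qdel S * qH S)

theorem qcrs_mul (C m : M3 k) : qcrs (C * m) = qcrs C * qcrs m := by
  ext i j
  fin_cases i <;> fin_cases j <;>
    simp [qcrs, qcr, Matrix.mul_apply, Fin.sum_univ_three] <;> ring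

theorem qcrs_tr (C : M3 k) : C.transpose * qcrs C = C.det • (1 : M3 k) := by
  ext i j
  fin_cases i <;> fin_cases j <;>
    simp [qcrs, qcr, Matrix.mul_apply, Fin.sum_univ_three, Matrix.det_fin_three] <;> ring

theorem qcrs_tr2 (C : M3 k) : C * (qcrs C).transpose = C.det • (1 : M3 k) := by
  ext i j
  fin_cases i <;> fin_cases j <;>
    simp [qcrs, qcr, Matrix.mul_apply, Fin.sum_univ_three, Matrix.det_fin_three] <;> ring

theorem qcrs_smul (a : k) (C : M3 k) : qcrs (a • C) = a ^ 2 • qcrs C := by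
  ext i j
  fin_cases i <;> fin_cases j <;> simp [qcrs, qcr] <;> ring

theorem qcrs_transpose (C : M3 k) : qcrs C.transpose = (qcrs C).transpose := by
  ext i j
  fin_cases i <;> fin_cases j <;> simp [qcrs, qcr] <;> ring

theorem qax_conj (R N : M3 k) : qax (R * N * R.transpose) = (qcrs R).mulVec (qax N) := by
  ext i
  fin_cases i <;>
    simp [qcrs, qcr, qax, Matrix.mul_apply, Matrix.mulVec, dotProduct, Fin.sum_univ_three] <;> ring

theorem qcr_mulVec (R : M3 k) (x y : Fin 3 → k) :
    qcr (R.mulVec x) (R.mulVec y) = (qcrs R).mulVec (qcr x y) := by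
  ext i
  fin_cases i <;>
    simp [qcrs, qcr, Matrix.mulVec, dotProduct, Fin.sum_univ_three] <;> ring

theorem qcr_smul (a b : k) (x y : Fin 3 → k) : qcr (a • x) (b • y) = (a * b) • qcr x y := by
  ext i
  fin_cases i <;> simp [qcr] <;> ring

theorem qax_symm (A B : M3 k) (hA : A.transpose = A) (hB : B.transpose = B) :
    qax (B * A) = - qax (A * B) := by
  have : B * A = (A * B).transpose := by rw [Matrix.transpose_mul, hA, hB]
  rw [this]
  ext i
  fin_cases i <;> simp [qax]

theorem qax_self (A : M3 k) (hA : A.transpose = A) : qax (A * A) = 0 := by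
  have h : ∀ i j, (A * A) i j = (A * A) j i := by
    intro i j
    conv_lhs => rw [← hA, ← Matrix.transpose_mul]
    rfl
  ext i
  fin_cases i
  · simp [qax, h 1 2]
  · simp [qax, h 2 0]
  · simp [qax, h 0 1]

theorem qax_add (A B : M3 k) : qax (A + B) = qax A + qax B := by
  ext i
  fin_cases i <;> simp [qax] <;> ring

theorem qax_smul (a : k) (A : M3 k) : qax (a • A) = a • qax A := by
  ext i
  fin_cases i <;> simp [qax] <;> ring

def qsym (S : Fin 3 → M3 k) : Prop := ∀ i, (S i).transpose = S i

theorem qax_mix (S : Fin 3 → M3 k) (hS : qsym S) (x y : Fin 3 → k) :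
    qax ((∑ j, x j • S j) * (∑ j, y j • S j)) = Matrix.vecMul (qcr x y) (qbrk S) := by
  have e1 := qax_symm _ _ (hS 0) (hS 1)
  have e2 := qax_symm _ _ (hS 1) (hS 2)
  have e3 := qax_symm _ _ (hS 2) (hS 0)
  simp only [Fin.sum_univ_three, add_mul, mul_add, smul_mul_assoc, mul_smul_comm, qax_add,
    qax_smul, qax_self _ (hS _), e1, e2, e3]
  ext i
  simp [Matrix.vecMul, dotProduct, Fin.sum_univ_three, qcr, qbrk]
  ring

theorem qbrk_mix (C : M3 k) (S : Fin 3 → M3 k) (hS : qsym S) :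
    qbrk (qmix C S) = qcrs C * qbrk S := by
  ext i j
  fin_cases i <;>
  · simp only [qbrk, qmix, qax_mix S hS]
    rfl

theorem qtri_mix (C b : M3 k) (S : Fin 3 → M3 k) :
    qtri (qmix C S) b = qtri S (C.transpose * b) := by
  ext i
  simp [qtri, qmix, Matrix.mulVec, dotProduct, Fin.sum_univ_three, Matrix.mul_apply,
    Matrix.transpose_apply]
  ring

theorem qtri_smul (a : k) (b : M3 k) (S : Fin 3 → M3 k) :
    qtri S (a • b) = a • qtri S b := by
  ext i
  simp [qtri, Matrix.mulVec, dotProduct, Fin.sum_univ_three]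
  ring

theorem qe_mix (C : M3 k) (S : Fin 3 → M3 k) (hS : qsym S) :
    qe (qmix C S) = C.det • qe S := by
  rw [qe, qbrk_mix C S hS, qtri_mix, ← mul_assoc, qcrs_tr, smul_mul_assoc, one_mul, qtri_smul, qe]

theorem qm_mix (C : M3 k) (S : Fin 3 → M3 k) (hS : qsym S) :
    qm (qmix C S) = C.det • (C * qm S) := by
  ext i j
  simp only [qm, qe_mix C S hS]
  simp [qmix, Matrix.mulVec, dotProduct, Fin.sum_univ_three, Matrix.mul_apply]
  ring

theorem qc_mix (C : M3 k) (S : Fin 3 → M3 k) (hS : qsym S) :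
    qc (qmix C S) = C.det ^ 2 • (qcrs C * qc S) := by
  rw [qc, qm_mix C S hS, qcrs_smul, qcrs_mul, qc]

theorem qd_mix (C : M3 k) (S : Fin 3 → M3 k) (hS : qsym S) :
    qd (qmix C S) = C.det ^ 3 • qd S := by
  rw [qd, qc_mix C S hS, qtri_smul, qtri_mix, ← mul_assoc, qcrs_tr, smul_mul_assoc, one_mul,
    qtri_smul, qd, smul_smul]
  congr 1
  ring

theorem qz_eq (S : Fin 3 → M3 k) (w : Fin 3 → k) (i j : Fin 3) :
    qz S w i j = ∑ a, (qc S a ⬝ᵥ w) * S a i j := by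
  simp [qz, Fin.sum_univ_three]

theorem qz_mix (C : M3 k) (S : Fin 3 → M3 k) (hS : qsym S) (w : Fin 3 → k) :
    qz (qmix C S) w = C.det ^ 3 • qz S w := by
  have h : ∀ a b, ∑ i, C i a * qcrs C i b = C.det * (1 : M3 k) a b := by
    intro a b
    have := congrFun (congrFun (qcrs_tr C) a) b
    simpa [Matrix.mul_apply] using this
  have key : ∀ p q, ∑ a, ((qcrs C * qc S) a ⬝ᵥ w) * qmix C S a p q
      = C.det * ∑ a, (qc S a ⬝ᵥ w) * S a p q := by
    intro p q
    have : ∀ a, (qcrs C * qc S) a ⬝ᵥ w = ∑ b, qcrs C a b * (qc S b ⬝ᵥ w) := by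
      intro a
      simp [dotProduct, Matrix.mul_apply, Fin.sum_univ_three]
      ring
    simp only [this]
    have h00 := h 0 0
    have h01 := h 0 1
    have h02 := h 0 2
    have h10 := h 1 0
    have h11 := h 1 1
    have h12 := h 1 2
    have h20 := h 2 0
    have h21 := h 2 1
    have h22 := h 2 2
    simp [Fin.sum_univ_three] at h00 h01 h02 h10 h11 h12 h20 h21 h22
    simp [Fin.sum_univ_three, qmix]
    generalize qc S 0 ⬝ᵥ w = w0
    generalize qc S 1 ⬝ᵥ w = w1
    generalize qc S 2 ⬝ᵥ w = w2
    linear_combination (w0 * S 0 p q) * h00 + (w1 * S 0 p q) * h01 + (w2 * S 0 p q) * h02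
      + (w0 * S 1 p q) * h10 + (w1 * S 1 p q) * h11 + (w2 * S 1 p q) * h12
      + (w0 * S 2 p q) * h20 + (w1 * S 2 p q) * h21 + (w2 * S 2 p q) * h22
  ext p q
  rw [qz_eq, qc_mix C S hS, Matrix.smul_apply, qz_eq, smul_eq_mul]
  have e : ∀ a, (C.det ^ 2 • (qcrs C * qc S)) a ⬝ᵥ w = C.det ^ 2 * ((qcrs C * qc S) a ⬝ᵥ w) := by
    intro a
    simp [dotProduct, Fin.sum_univ_three]
    ring
  simp only [e, mul_assoc]
  rw [← Finset.mul_sum, key]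
  ring

theorem qz_smul (S : Fin 3 → M3 k) (a : k) (w : Fin 3 → k) : qz S (a • w) = a • qz S w := by
  ext p q
  simp [qz, Fin.sum_univ_three]
  ring

theorem qbil_smul (N : M3 k) (a b c : k) (x y : Fin 3 → k) :
    qbil (a • N) (b • x) (c • y) = a * b * c * qbil N x y := by
  simp [qbil, Matrix.mulVec, dotProduct, Fin.sum_univ_three]
  ring

end core

set_option linter.unusedSimpArgs false

section conjugation
variable {k : Type*} [CommRing k]

def qrot (R : M3 k) : Prop := R.transpose * R = 1 ∧ qcrs R = R

theorem qsym_conj (R : M3 k) (S : Fin 3 → M3 k) (hS : qsym S) : qsym (qconj R S) := by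
  intro i
  simp [qconj, Matrix.transpose_mul, hS i, mul_assoc]

theorem qsym_mix (C : M3 k) (S : Fin 3 → M3 k) (hS : qsym S) : qsym (qmix C S) := by
  intro i
  simp [qmix, Matrix.transpose_sum, Matrix.transpose_smul, hS _]

theorem qconj_mul {R : M3 k} (hR : qrot R) (A B : M3 k) :
    (R * A * R.transpose) * (R * B * R.transpose) = R * (A * B) * R.transpose := by
  calc _ = R * A * (R.transpose * R) * B * R.transpose := by simp only [mul_assoc]
    _ = _ := by rw [hR.1]; simp only [mul_assoc, one_mul]

theorem qconj_mulVec {R : M3 k} (hR : qrot R) (A : M3 k) (x : Fin 3 → k) :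
    (R * A * R.transpose).mulVec (R.mulVec x) = R.mulVec (A.mulVec x) := by
  rw [Matrix.mulVec_mulVec, mul_assoc, hR.1, mul_one, Matrix.mulVec_mulVec]

theorem mul_tr_row (b R : M3 k) (i : Fin 3) : (b * R.transpose) i = R.mulVec (b i) := by
  ext j
  simp [Matrix.mul_apply, Matrix.mulVec, dotProduct, mul_comm]

theorem qbrk_conj {R : M3 k} (hR : qrot R) (S : Fin 3 → M3 k) :
    qbrk (qconj R S) = qbrk S * R.transpose := by
  ext i j
  rw [mul_tr_row]
  fin_cases i <;> simp [qbrk, qconj, qconj_mul hR, qax_conj, hR.2] <;> rfl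

theorem qtri_conj {R : M3 k} (hR : qrot R) (S : Fin 3 → M3 k) (b : M3 k) :
    qtri (qconj R S) (b * R.transpose) = R.mulVec (qtri S b) := by
  simp only [qtri, qconj, mul_tr_row, qconj_mulVec hR, Fin.sum_univ_three, Matrix.mulVec_add]

theorem qe_conj {R : M3 k} (hR : qrot R) (S : Fin 3 → M3 k) :
    qe (qconj R S) = R.mulVec (qe S) := by
  rw [qe, qbrk_conj hR, qtri_conj hR, qe]

theorem qm_conj {R : M3 k} (hR : qrot R) (S : Fin 3 → M3 k) :
    qm (qconj R S) = qm S * R.transpose := by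
  ext i j
  rw [mul_tr_row]
  simp only [qm, qe_conj hR, Matrix.of_apply]
  rw [qconj, qconj_mulVec hR]
  rfl

theorem qc_conj {R : M3 k} (hR : qrot R) (S : Fin 3 → M3 k) :
    qc (qconj R S) = qc S * R.transpose := by
  rw [qc, qm_conj hR, qcrs_mul, qcrs_transpose, hR.2, qc]

theorem qd_conj {R : M3 k} (hR : qrot R) (S : Fin 3 → M3 k) :
    qd (qconj R S) = R.mulVec (qd S) := by
  rw [qd, qc_conj hR, qtri_conj hR, qd]

theorem qh_conj {R : M3 k} (hR : qrot R) (S : Fin 3 → M3 k) :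
    qh (qconj R S) = R.mulVec (qh S) := by
  rw [qh, qe_conj hR, qd_conj hR, qcr_mulVec, hR.2, qh]

theorem qg_conj {R : M3 k} (hR : qrot R) (S : Fin 3 → M3 k) :
    qg (qconj R S) = R.mulVec (qg S) := by
  rw [qg, qe_conj hR, qh_conj hR, qcr_mulVec, hR.2, qg]

theorem qdot_conj {R : M3 k} (hR : qrot R) (x y : Fin 3 → k) :
    R.mulVec x ⬝ᵥ R.mulVec y = x ⬝ᵥ y := by
  rw [Matrix.dotProduct_mulVec, ← Matrix.mulVec_transpose, Matrix.mulVec_mulVec, hR.1,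
    Matrix.one_mulVec]

theorem qz_conj {R : M3 k} (hR : qrot R) (S : Fin 3 → M3 k) (w : Fin 3 → k) :
    qz (qconj R S) (R.mulVec w) = R * qz S w * R.transpose := by
  simp only [qz, qc_conj hR, mul_tr_row, qdot_conj hR, Fin.sum_univ_three, qconj, mul_add, add_mul,
    mul_smul_comm, smul_mul_assoc]

theorem qbil_conj {R : M3 k} (hR : qrot R) (N : M3 k) (x y : Fin 3 → k) :
    qbil (R * N * R.transpose) (R.mulVec x) (R.mulVec y) = qbil N x y := by
  rw [qbil, qconj_mulVec hR, qdot_conj hR, qbil]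

theorem qM_conj {R : M3 k} (hR : qrot R) (S : Fin 3 → M3 k) :
    qM (qconj R S) = R * qM S * R.transpose := by
  simp [qM, qm_conj hR, Matrix.transpose_mul, mul_assoc]

theorem qrot_det {R : M3 k} (hR : qrot R) : R.det = 1 := by
  have h := qcrs_tr R
  rw [hR.2, hR.1] at h
  have := congrFun (congrFun h 0) 0
  simpa using this.symm

theorem qdel_conj {R : M3 k} (hR : qrot R) (S : Fin 3 → M3 k) :
    qdel (qconj R S) = qdel S := by
  rw [qdel, qm_conj hR, Matrix.det_mul, Matrix.det_transpose, qrot_det hR, mul_one, qdel]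

theorem qnum_conj {R : M3 k} (hR : qrot R) (S : Fin 3 → M3 k) :
    qnum (qconj R S) = qnum S := by
  simp only [qnum, qq1, qq2, qq3, qeps, qe_conj hR, qh_conj hR, qg_conj hR, qz_conj hR,
    qM_conj hR, qbil_conj hR, qdot_conj hR]

theorem qden_conj {R : M3 k} (hR : qrot R) (S : Fin 3 → M3 k) :
    qden (qconj R S) = qden S := by
  simp only [qden, qeps, qH, qMee, qe_conj hR, qh_conj hR, qg_conj hR, qz_conj hR,
    qM_conj hR, qbil_conj hR, qdot_conj hR, qdel_conj hR]

theorem qnd_conj {R : M3 k} (hR : qrot R) (S : Fin 3 → M3 k) :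
    qnd (qconj R S) = qnd S := by
  simp only [qnd, qq1, qq2, qq3, qeps, qH, qMee, qe_conj hR, qh_conj hR, qg_conj hR, qz_conj hR,
    qM_conj hR, qbil_conj hR, qdot_conj hR, qdel_conj hR]

theorem qh_mix (C : M3 k) (S : Fin 3 → M3 k) (hS : qsym S) :
    qh (qmix C S) = C.det ^ 4 • qh S := by
  rw [qh, qe_mix C S hS, qd_mix C S hS, qcr_smul, qh]; congr 1; ring

theorem qg_mix (C : M3 k) (S : Fin 3 → M3 k) (hS : qsym S) :
    qg (qmix C S) = C.det ^ 5 • qg S := by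
  rw [qg, qe_mix C S hS, qh_mix C S hS, qcr_smul, qg]; congr 1; ring

theorem qM_mix (C : M3 k) (S : Fin 3 → M3 k) (hS : qsym S) (s : k)
    (hC : C.transpose * C = s • 1) :
    qM (qmix C S) = (C.det ^ 2 * s) • qM S := by
  rw [qM, qm_mix C S hS, Matrix.transpose_smul, Matrix.transpose_mul, smul_mul_smul_comm]
  have : (qm S).transpose * C.transpose * (C * qm S)
    = (qm S).transpose * (C.transpose * C) * qm S := by simp only [mul_assoc]
  rw [this, hC, mul_smul_comm, mul_one, smul_mul_assoc, smul_smul, qM, sq]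

theorem qdel_mix (C : M3 k) (S : Fin 3 → M3 k) (hS : qsym S) :
    qdel (qmix C S) = C.det ^ 4 * qdel S := by
  rw [qdel, qm_mix C S hS, Matrix.det_smul, Matrix.det_mul, qdel]
  simp; ring

theorem qdot_smul (a b : k) (x y : Fin 3 → k) : (a • x) ⬝ᵥ (b • y) = a * b * (x ⬝ᵥ y) := by
  simp [dotProduct, Fin.sum_univ_three]; ring

theorem qeps_mix (C : M3 k) (S : Fin 3 → M3 k) (hS : qsym S) :
    qeps (qmix C S) = C.det ^ 2 * qeps S := by
  rw [qeps, qe_mix C S hS, qdot_smul, qeps]; ring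

theorem qH_mix (C : M3 k) (S : Fin 3 → M3 k) (hS : qsym S) :
    qH (qmix C S) = C.det ^ 8 * qH S := by
  rw [qH, qh_mix C S hS, qdot_smul, qH]; ring

theorem qq1_mix (C : M3 k) (S : Fin 3 → M3 k) (hS : qsym S) :
    qq1 (qmix C S) = C.det ^ 12 * qq1 S := by
  rw [qq1, qh_mix C S hS, qz_mix C S hS, qe_mix C S hS, qz_smul, smul_smul, qbil_smul, qq1]; ring

theorem qq2_mix (C : M3 k) (S : Fin 3 → M3 k) (hS : qsym S) :
    qq2 (qmix C S) = C.det ^ 13 * qq2 S := by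
  rw [qq2, qh_mix C S hS, qz_mix C S hS, qe_mix C S hS, qg_mix C S hS, qz_smul, smul_smul,
    qbil_smul, qq2]; ring

theorem qq3_mix (C : M3 k) (S : Fin 3 → M3 k) (hS : qsym S) :
    qq3 (qmix C S) = C.det ^ 15 * qq3 S := by
  rw [qq3, qh_mix C S hS, qz_mix C S hS, qz_smul, smul_smul, qbil_smul, qq3]; ring

/-- invariance of the eight quotients under orthogonal mixing -/
theorem qinv_mix (C : M3 k) (S : Fin 3 → M3 k) (hS : qsym S) (s : k)
    (hC : C.transpose * C = s • 1) (i : Fin 8) :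
    qnum (qmix C S) i * qden S i = qden (qmix C S) i * qnum S i := by
  fin_cases i <;>
  · simp only [qnum, qden, qMee, qq1_mix C S hS, qq2_mix C S hS, qq3_mix C S hS, qH_mix C S hS,
      qeps_mix C S hS, qdel_mix C S hS, qM_mix C S hS s hC, qe_mix C S hS, qh_mix C S hS,
      qg_mix C S hS, qbil_smul]
    simp
    ring

end conjugation

section functoriality
variable {k l : Type*} [CommRing k] [CommRing l]

def qmap (φ : k →+* l) (S : Fin 3 → M3 k) : Fin 3 → M3 l := fun i => (S i).map φ

theorem qax_map (φ : k →+* l) (N : M3 k) : qax (N.map φ) = φ ∘ qax N := by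
  ext i; fin_cases i <;> simp [qax]

theorem qcr_map (φ : k →+* l) (x y : Fin 3 → k) : qcr (φ ∘ x) (φ ∘ y) = φ ∘ qcr x y := by
  ext i; fin_cases i <;> simp [qcr]

theorem qcrs_map (φ : k →+* l) (m : M3 k) : qcrs (m.map φ) = (qcrs m).map φ := by
  ext i j; fin_cases i <;> fin_cases j <;> simp [qcrs, qcr]

theorem qbrk_map (φ : k →+* l) (S : Fin 3 → M3 k) : qbrk (qmap φ S) = (qbrk S).map φ := by
  ext i j
  fin_cases i <;> simp [qbrk, qmap, ← Matrix.map_mul, qax_map]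

theorem qtri_map (φ : k →+* l) (S : Fin 3 → M3 k) (b : M3 k) :
    qtri (qmap φ S) (b.map φ) = φ ∘ qtri S b := by
  ext i
  simp [qtri, qmap, Matrix.mulVec, dotProduct, Fin.sum_univ_three]

theorem qe_map (φ : k →+* l) (S : Fin 3 → M3 k) : qe (qmap φ S) = φ ∘ qe S := by
  rw [qe, qbrk_map, qtri_map, qe]

theorem qm_map (φ : k →+* l) (S : Fin 3 → M3 k) : qm (qmap φ S) = (qm S).map φ := by
  ext i j
  simp [qm, qe_map, qmap, Matrix.mulVec, dotProduct, Fin.sum_univ_three]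

theorem qc_map (φ : k →+* l) (S : Fin 3 → M3 k) : qc (qmap φ S) = (qc S).map φ := by
  rw [qc, qm_map, qcrs_map, qc]

theorem qd_map (φ : k →+* l) (S : Fin 3 → M3 k) : qd (qmap φ S) = φ ∘ qd S := by
  rw [qd, qc_map, qtri_map, qd]

theorem qh_map (φ : k →+* l) (S : Fin 3 → M3 k) : qh (qmap φ S) = φ ∘ qh S := by
  rw [qh, qe_map, qd_map, qcr_map, qh]

theorem qg_map (φ : k →+* l) (S : Fin 3 → M3 k) : qg (qmap φ S) = φ ∘ qg S := by
  rw [qg, qe_map, qh_map, qcr_map, qg]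

theorem qz_map (φ : k →+* l) (S : Fin 3 → M3 k) (w : Fin 3 → k) :
    qz (qmap φ S) (φ ∘ w) = (qz S w).map φ := by
  ext i j
  simp [qz, qc_map, qmap, dotProduct, Fin.sum_univ_three]

theorem qbil_map (φ : k →+* l) (N : M3 k) (x y : Fin 3 → k) :
    qbil (N.map φ) (φ ∘ x) (φ ∘ y) = φ (qbil N x y) := by
  simp [qbil, Matrix.mulVec, dotProduct, Fin.sum_univ_three]

theorem qM_map (φ : k →+* l) (S : Fin 3 → M3 k) : qM (qmap φ S) = (qM S).map φ := by
  rw [qM, qm_map, qM, Matrix.map_mul, Matrix.transpose_map]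

theorem qdot_map (φ : k →+* l) (x y : Fin 3 → k) : (φ ∘ x) ⬝ᵥ (φ ∘ y) = φ (x ⬝ᵥ y) := by
  simp [dotProduct, Fin.sum_univ_three]

theorem qdel_map (φ : k →+* l) (S : Fin 3 → M3 k) : qdel (qmap φ S) = φ (qdel S) := by
  rw [qdel, qm_map, qdel, RingHom.map_det]; rfl

theorem qnum_map (φ : k →+* l) (S : Fin 3 → M3 k) (i : Fin 8) :
    qnum (qmap φ S) i = φ (qnum S i) := by
  simp only [qnum, qq1, qq2, qq3, qeps, qe_map, qh_map, qg_map, qz_map,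
    qM_map, qbil_map, qdot_map]
  fin_cases i <;> simp

theorem qden_map (φ : k →+* l) (S : Fin 3 → M3 k) (i : Fin 8) :
    qden (qmap φ S) i = φ (qden S i) := by
  simp only [qden, qeps, qH, qMee, qe_map, qh_map, qg_map, qz_map,
    qM_map, qbil_map, qdot_map, qdel_map]
  fin_cases i <;> simp

theorem qnd_map (φ : k →+* l) (S : Fin 3 → M3 k) :
    qnd (qmap φ S) = φ (qnd S) := by
  simp only [qnd, qq1, qq2, qq3, qeps, qH, qMee, qe_map, qh_map, qg_map, qz_map,
    qM_map, qbil_map, qdot_map, qdel_map]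
  simp

end functoriality

set_option linter.unusedSimpArgs false
section slice
variable {k : Type*} [CommRing k]

def qt6 (n1 n2 n3 l1 l2 l3 : k) : Fin 3 → M3 k :=
  ![!![1, 0, 0; 0, n1, l1; 0, l1, -1 - n1],
    !![0, 1, 0; 1, n2, l2; 0, l2, -n2],
    !![0, 0, 1; 0, n3, l3; 1, l3, -n3]]

def qt (n1 n2 n3 l1 l2 : k) : Fin 3 → M3 k := qt6 n1 n2 n3 l1 l2 (-n2)

theorem qsym_t6 (n1 n2 n3 l1 l2 l3 : k) : qsym (qt6 n1 n2 n3 l1 l2 l3) := by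
  intro i
  ext a b
  fin_cases i <;> fin_cases a <;> fin_cases b <;> simp [qt6]

theorem qsym_t (n1 n2 n3 l1 l2 : k) : qsym (qt n1 n2 n3 l1 l2) := qsym_t6 _ _ _ _ _ _

theorem qe_t6 (n1 n2 n3 l1 l2 l3 : k) : qe (qt6 n1 n2 n3 l1 l2 l3) =
    ![4 + 2 * l3 * n2 - 2 * l2 * n3, -4 * l3 * n1 + 2 * n2 + 4 * l1 * n3,
      -4 * l1 * n2 - 2 * n3 + (4 + 4 * n1) * l2] := by
  ext i
  fin_cases i <;>
    simp [qe, qt6, qtri, qbrk, qax, Matrix.mul_apply, Matrix.mulVec, dotProduct,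
      Fin.sum_univ_three] <;> ring

def qgood (n1 n2 n3 l1 l2 : k) : Prop :=
  2 * l1 * n3 + (2 * n1 + 1) * n2 = 0 ∧ 2 * (1 + n1) * l2 = n3 + 2 * l1 * n2

def qkap (n2 n3 l2 : k) : k := 4 - 2 * n2 ^ 2 - 2 * l2 * n3

variable {n1 n2 n3 l1 l2 : k}

theorem qe_t (h : qgood n1 n2 n3 l1 l2) :
    qe (qt n1 n2 n3 l1 l2) = ![qkap n2 n3 l2, 0, 0] := by
  rw [qt, qe_t6]
  obtain ⟨h1, h2⟩ := h
  ext i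
  fin_cases i
  · simp [qkap]; ring
  · simp; linear_combination 2 * h1
  · simp; linear_combination 2 * h2

theorem qm_t6 (κ l3 : k) (h : qe (qt6 n1 n2 n3 l1 l2 l3) = ![κ, 0, 0]) :
    qm (qt6 n1 n2 n3 l1 l2 l3) = κ • 1 := by
  ext i j
  simp only [qm, h]
  fin_cases i <;> fin_cases j <;> simp [qt6, Matrix.mulVec, dotProduct, Fin.sum_univ_three]

theorem qc_t6 (κ l3 : k) (h : qe (qt6 n1 n2 n3 l1 l2 l3) = ![κ, 0, 0]) :
    qc (qt6 n1 n2 n3 l1 l2 l3) = κ ^ 2 • 1 := by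
  rw [qc, qm_t6 κ l3 h, qcrs_smul]
  congr 1
  ext i j
  fin_cases i <;> fin_cases j <;> simp [qcrs, qcr]

theorem qd_t6 (κ l3 : k) (h : qe (qt6 n1 n2 n3 l1 l2 l3) = ![κ, 0, 0]) :
    qd (qt6 n1 n2 n3 l1 l2 l3) = ![κ ^ 2 * 3, κ ^ 2 * (n2 + l3), κ ^ 2 * (l2 - n3)] := by
  rw [qd, qc_t6 κ l3 h, qtri_smul]
  ext i
  fin_cases i <;> simp [qtri, qt6, Matrix.mulVec, dotProduct, Fin.sum_univ_three] <;> ring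

theorem qd_t (h : qgood n1 n2 n3 l1 l2) : qd (qt n1 n2 n3 l1 l2) =
    ![qkap n2 n3 l2 ^ 2 * 3, 0, qkap n2 n3 l2 ^ 2 * (l2 - n3)] := by
  rw [qt, qd_t6 _ _ (qe_t h)]
  simp

theorem qh_t (h : qgood n1 n2 n3 l1 l2) : qh (qt n1 n2 n3 l1 l2) =
    ![0, -(qkap n2 n3 l2 ^ 3 * (l2 - n3)), 0] := by
  rw [qh, qe_t h, qd_t h]
  ext i
  fin_cases i <;> simp [qcr]; ring

theorem qg_t (h : qgood n1 n2 n3 l1 l2) : qg (qt n1 n2 n3 l1 l2) =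
    ![0, 0, qkap n2 n3 l2 ^ 4 * (l2 - n3)] := by
  rw [qg, qe_t h, qh_t h]
  ext i
  fin_cases i <;> simp [qcr]; ring

theorem qz_t (h : qgood n1 n2 n3 l1 l2) (w : Fin 3 → k) : qz (qt n1 n2 n3 l1 l2) w =
    qkap n2 n3 l2 ^ 2 • ∑ i, w i • qt n1 n2 n3 l1 l2 i := by
  rw [qz, qt, qc_t6 _ _ (qe_t h)]
  ext i j
  simp [Fin.sum_univ_three, dotProduct]
  ring

theorem qvals (C : M3 k) (h : qgood n1 n2 n3 l1 l2) (d κ η : k) (hd : C.det = d)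
    (hκ : qkap n2 n3 l2 = κ) (hη : l2 - n3 = η) (S : Fin 3 → M3 k)
    (hS : S = qmix C (qt n1 n2 n3 l1 l2)) :
    qeps S = d ^ 2 * κ ^ 2 ∧ qH S = d ^ 8 * κ ^ 6 * η ^ 2 ∧ qdel S = d ^ 4 * κ ^ 3 ∧
    qq1 S = d ^ 12 * κ ^ 9 * η ^ 2 * n1 ∧ qq2 S = - (d ^ 13 * κ ^ 10 * η ^ 2 * l1) ∧
    qq3 S = - (d ^ 15 * κ ^ 11 * η ^ 3 * n2) ∧ qe S = ![d * κ, 0, 0] ∧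
    qh S = ![0, - (d ^ 4 * κ ^ 3 * η), 0] ∧ qg S = ![0, 0, d ^ 5 * κ ^ 4 * η] ∧
    qM S = (d ^ 2 * κ ^ 2) • (C.transpose * C) := by
  have hs := qsym_t n1 n2 n3 l1 l2
  have He := qe_mix C _ hs
  have Hh := qh_mix C _ hs
  have Hg := qg_mix C _ hs
  rw [qe_t h, hd, hκ] at He
  rw [qh_t h, hd, hκ, hη] at Hh
  rw [qg_t h, hd, hκ, hη] at Hg
  subst hS
  refine ⟨?_, ?_, ?_, ?_, ?_, ?_, ?_, ?_, ?_, ?_⟩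
  · rw [qeps, He]; simp [dotProduct, Fin.sum_univ_three]; ring
  · rw [qH, Hh]; simp [dotProduct, Fin.sum_univ_three]; ring
  · rw [qdel_mix C _ hs, qdel, qt, qm_t6 _ _ (qe_t h), Matrix.det_smul, hκ, hd]; simp
  · rw [qq1_mix C _ hs, qq1, qz_t h, qh_t h, qe_t h, hκ, hη, hd]
    simp [qbil, qt, qt6, Matrix.mulVec, dotProduct, Fin.sum_univ_three]; ring
  · rw [qq2_mix C _ hs, qq2, qz_t h, qh_t h, qg_t h, qe_t h, hκ, hη, hd]
    simp [qbil, qt, qt6, Matrix.mulVec, dotProduct, Fin.sum_univ_three]; ring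
  · rw [qq3_mix C _ hs, qq3, qz_t h, qh_t h, hκ, hη, hd]
    simp [qbil, qt, qt6, Matrix.mulVec, dotProduct, Fin.sum_univ_three]; ring
  · rw [He]; simp
  · rw [Hh]; simp; ring
  · rw [Hg]; simp; ring
  · rw [qM, qm_mix C _ hs, qt, qm_t6 _ _ (qe_t h), hκ, hd]
    simp [Matrix.transpose_smul, smul_smul, Matrix.transpose_mul]
    congr 1; ring

end slice

section slicefield
variable {k : Type*} [Field k] {n1 n2 n3 l1 l2 : k}

theorem qnd_slice (C : M3 k) (h : qgood n1 n2 n3 l1 l2) :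
    qnd (qmix C (qt n1 n2 n3 l1 l2)) ≠ 0 ↔
      (C.det ≠ 0 ∧ qkap n2 n3 l2 ≠ 0 ∧ l2 - n3 ≠ 0 ∧ l1 ≠ 0 ∧ n2 ≠ 0 ∧ 1 + n1 ≠ 0 ∧
        (C.transpose * C) 0 0 ≠ 0) := by
  obtain ⟨a1, a2, a3, a4, a5, a6, a7, a8, a9, a10⟩ := qvals C h _ _ _ rfl rfl rfl _ rfl
  have : qnd (qmix C (qt n1 n2 n3 l1 l2)) = C.det ^ 58 * qkap n2 n3 l2 ^ 45 * (l2 - n3) ^ 9 * l1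
      * n2 * (1 + n1) * (C.transpose * C) 0 0 := by
    rw [qnd, qMee, a1, a2, a3, a4, a5, a6, a7, a10]
    simp only [qbil, Matrix.mulVec, dotProduct, Fin.sum_univ_three]
    simp
    ring
  rw [this]
  simp only [ne_eq, mul_eq_zero, pow_eq_zero_iff', not_or]
  tauto

theorem qy_slice (C : M3 k) (h : qgood n1 n2 n3 l1 l2)
    (hnd : qnd (qmix C (qt n1 n2 n3 l1 l2)) ≠ 0) (i : Fin 8) :
    qden (qmix C (qt n1 n2 n3 l1 l2)) i ≠ 0 ∧
    qnum (qmix C (qt n1 n2 n3 l1 l2)) i / qden (qmix C (qt n1 n2 n3 l1 l2)) i =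
    (![n1, l1 ^ 2, n2 ^ 2, (C.transpose * C) 1 1 / (C.transpose * C) 0 0,
      (C.transpose * C) 2 2 / (C.transpose * C) 0 0,
      (C.transpose * C) 0 1 * n2 / (C.transpose * C) 0 0,
      (C.transpose * C) 1 2 * l1 / (C.transpose * C) 0 0,
      (C.transpose * C) 0 2 * l1 * n2 / (C.transpose * C) 0 0] : Fin 8 → k) i := by
  obtain ⟨b1, b2, b3, b4, b5, b6, b7⟩ := (qnd_slice C h).1 hnd
  obtain ⟨a1, a2, a3, a4, a5, a6, a7, a8, a9, a10⟩ := qvals C h _ _ _ rfl rfl rfl _ rfl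
  simp only [qnum, qden, qMee, a1, a2, a3, a4, a5, a6, a7, a8, a9, a10]
  generalize C.transpose * C = N at *
  generalize C.det = d at *
  generalize qkap n2 n3 l2 = κ at *
  generalize l2 - n3 = η at *
  clear a1 a2 a3 a4 a5 a6 a7 a8 a9 a10
  fin_cases i <;>
  · simp [qbil, Matrix.mulVec, dotProduct, Fin.sum_univ_three, b1, b2, b3, b4, b5, b6, b7]
    try field_simp

end slicefield

section canonring
variable {k : Type*} [CommRing k]

theorem qmix_mul (C D : M3 k) (S : Fin 3 → M3 k) : qmix C (qmix D S) = qmix (C * D) S := by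
  funext i
  ext a b
  simp [qmix, Matrix.mul_apply, Fin.sum_univ_three]
  ring

theorem qmix_one (S : Fin 3 → M3 k) : qmix 1 S = S := by
  funext i
  ext a b
  simp [qmix, Matrix.one_apply]

theorem qconj_mix (R C : M3 k) (S : Fin 3 → M3 k) :
    qconj R (qmix C S) = qmix C (qconj R S) := by
  funext i
  simp only [qconj, qmix, Fin.sum_univ_three, mul_add, add_mul, mul_smul_comm, smul_mul_assoc]

theorem qconj_qconj (R T : M3 k) (S : Fin 3 → M3 k) :
    qconj R (qconj T S) = qconj (R * T) S := by
  funext i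
  simp [qconj, Matrix.transpose_mul, mul_assoc]

theorem qconj_one (S : Fin 3 → M3 k) : qconj 1 S = S := by
  funext i
  simp [qconj]

theorem qconj_trace {R : M3 k} (hR : qrot R) (S : Fin 3 → M3 k) (i : Fin 3) :
    (qconj R S i).trace = (S i).trace := by
  rw [qconj, Matrix.trace_mul_comm, ← mul_assoc, hR.1, one_mul]

theorem qmix_trace (C : M3 k) (S : Fin 3 → M3 k) (h : ∀ i, (S i).trace = 0) (i : Fin 3) :
    (qmix C S i).trace = 0 := by
  simp [qmix, Matrix.trace_sum, Matrix.trace_smul, h]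

theorem qrot_mul {R T : M3 k} (hR : qrot R) (hT : qrot T) : qrot (R * T) := by
  refine ⟨?_, by rw [qcrs_mul, hR.2, hT.2]⟩
  rw [Matrix.transpose_mul, mul_assoc, ← mul_assoc R.transpose, hR.1, one_mul, hT.1]

theorem qrot_tr {R : M3 k} (hR : qrot R) : qrot R.transpose := by
  refine ⟨?_, by rw [qcrs_transpose, hR.2]⟩
  rw [Matrix.transpose_transpose]
  exact mul_eq_one_comm.1 hR.1

theorem qrot_of {O : M3 k} (h : O.transpose * O = 1) (hd : O.det = 1) : qrot O := by
  refine ⟨h, ?_⟩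
  have := congrArg (fun M => O * M) (qcrs_tr O)
  simp only [← mul_assoc] at this
  rw [mul_eq_one_comm.1 h, one_mul, hd, one_smul, mul_one] at this
  exact this

end canonring

section canon
variable {k : Type*} [Field k]

theorem qrot_mk (u v : Fin 3 → k) (hu : u ⬝ᵥ u = 1) (hv : v ⬝ᵥ v = 1) (huv : u ⬝ᵥ v = 0) :
    qrot (Matrix.of ![u, v, qcr u v]) := by
  simp only [dotProduct, Fin.sum_univ_three] at hu hv huv
  constructor
  · rw [mul_eq_one_comm]
    ext i j
    fin_cases i <;> fin_cases j <;>
      simp [Matrix.mul_apply, Fin.sum_univ_three, qcr]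
    · linear_combination hu
    · linear_combination huv
    · ring
    · linear_combination huv
    · linear_combination hv
    · ring
    · ring
    · ring
    · linear_combination (v 0 * v 0 + v 1 * v 1 + v 2 * v 2) * hu + hv -
        (u 0 * v 0 + u 1 * v 1 + u 2 * v 2) * huv
  · ext i j
    fin_cases i <;> fin_cases j <;> simp [qcrs, qcr]
    · linear_combination u 0 * hv - v 0 * huv
    · linear_combination u 1 * hv - v 1 * huv
    · linear_combination u 2 * hv - v 2 * huv
    · linear_combination v 0 * hu - u 0 * huv
    · linear_combination v 1 * hu - u 1 * huv
    · linear_combination v 2 * hu - u 2 * huv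

theorem qcanon [IsAlgClosed k] [CharZero k] (S : Fin 3 → M3 k) (hS : qsym S)
    (htr : ∀ i, (S i).trace = 0) (hnd : qnd S ≠ 0) :
    ∃ R C : M3 k, ∃ n1 n2 n3 l1 l2 : k, qrot R ∧ qgood n1 n2 n3 l1 l2 ∧
      qconj R S = qmix C (qt n1 n2 n3 l1 l2) := by
  have hnd2 := hnd
  simp only [qnd, ne_eq, mul_eq_zero, not_or] at hnd
  obtain ⟨⟨⟨⟨⟨⟨b1, b2⟩, b3⟩, b4⟩, b5⟩, b6⟩, b7⟩ := hnd
  obtain ⟨r1, hr1⟩ := IsAlgClosed.exists_pow_nat_eq (qeps S) (n := 2) (by norm_num)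
  obtain ⟨r2, hr2⟩ := IsAlgClosed.exists_pow_nat_eq (qH S) (n := 2) (by norm_num)
  have c1 : r1 ≠ 0 := by rintro rfl; apply b1; rw [← hr1]; simp
  have c2 : r2 ≠ 0 := by rintro rfl; apply b2; rw [← hr2]; simp
  have heh : qe S ⬝ᵥ qh S = 0 := by
    simp [qh, qcr, dotProduct, Fin.sum_univ_three]; ring
  set u := r1⁻¹ • qe S with hu
  set v := r2⁻¹ • qh S with hv
  have e1 : u ⬝ᵥ u = 1 := by
    rw [hu, qdot_smul, ← qeps, ← hr1]; field_simp
  have e2 : v ⬝ᵥ v = 1 := by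
    rw [hv, qdot_smul, ← qH, ← hr2]; field_simp
  have e3 : u ⬝ᵥ v = 0 := by
    rw [hu, hv, qdot_smul, heh]; simp
  have hR := qrot_mk u v e1 e2 e3
  set R := (Matrix.of ![u, v, qcr u v] : M3 k) with hRd
  have hqe : qe S = r1 • u := by rw [hu, smul_smul, mul_inv_cancel₀ c1, one_smul]
  have hqh : qh S = r2 • v := by rw [hv, smul_smul, mul_inv_cancel₀ c2, one_smul]
  have f1 : qe (qconj R S) = ![r1, 0, 0] := by
    rw [qe_conj hR, hqe, Matrix.mulVec_smul]
    have : R.mulVec u = ![1, 0, 0] := by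
      simp only [dotProduct, Fin.sum_univ_three] at e1 e3
      ext i; fin_cases i <;> simp [hRd, Matrix.mulVec, dotProduct, Fin.sum_univ_three, qcr]
      · linear_combination e1
      · linear_combination e3
      · ring
    rw [this]; simp
  have f2 : qh (qconj R S) = ![0, r2, 0] := by
    rw [qh_conj hR, hqh, Matrix.mulVec_smul]
    have : R.mulVec v = ![0, 1, 0] := by
      simp only [dotProduct, Fin.sum_univ_three] at e2 e3
      ext i; fin_cases i <;> simp [hRd, Matrix.mulVec, dotProduct, Fin.sum_univ_three, qcr]
      · linear_combination e3
      · linear_combination e2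
      · ring
    rw [this]; simp
  have f3 : qdel (qconj R S) ≠ 0 := by rw [qdel_conj hR]; exact b3
  have f4 := qsym_conj R S hS
  have f5 : ∀ i, (qconj R S i).trace = 0 := fun i => by rw [qconj_trace hR, htr]
  obtain ⟨T, hT⟩ : ∃ T, T = qconj R S := ⟨_, rfl⟩
  rw [← hT] at f1 f2 f3 f4
  simp only [← hT] at f5
  have g1 : qd T 1 = 0 := by
    have := congrFun f2 2
    rw [qh, f1] at this
    simpa [qcr, c1] using this
  set C : M3 k := r1⁻¹ • qm T with hC
  have g2 : C.det ≠ 0 := by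
    rw [hC, Matrix.det_smul]
    exact mul_ne_zero (pow_ne_zero _ (inv_ne_zero c1)) f3
  have g2' : IsUnit C.det := isUnit_iff_ne_zero.2 g2
  set t := qmix C⁻¹ T with ht
  have g3 : T = qmix C t := by
    rw [ht, qmix_mul, Matrix.mul_nonsing_inv _ g2', qmix_one]
  have g4 : qsym t := qsym_mix _ _ f4
  have g5 : ∀ i, (t i).trace = 0 := qmix_trace _ _ f5
  have g6 : ∀ i j, T i j 0 = C i j := by
    intro i j
    rw [hC, Matrix.smul_apply, qm, f1]
    simp [Matrix.mulVec, dotProduct, Fin.sum_univ_three]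
    field_simp
  have g7 : ∀ i j, t i j 0 = (1 : M3 k) i j := by
    intro i j
    rw [← Matrix.nonsing_inv_mul _ g2', ht, Matrix.mul_apply]
    simp [qmix, Fin.sum_univ_three, g6]
  have g8 : t = qt6 (t 0 1 1) (t 1 1 1) (t 2 1 1) (t 0 1 2) (t 1 1 2) (t 2 1 2) := by
    have s : ∀ i a b, t i a b = t i b a := fun i a b => congrFun (congrFun (g4 i) b) a
    have tr : ∀ i, t i 2 2 = - t i 0 0 - t i 1 1 := fun i => by
      have := g5 i
      rw [Matrix.trace_fin_three] at this
      linear_combination this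
    funext i
    ext a b
    fin_cases i <;> fin_cases a <;> fin_cases b <;>
      simp [qt6, g7, tr, s _ 0 1, s _ 0 2, s _ 2 1]
  have g9 := qe_mix C t g4
  have g10 := qd_mix C t g4
  rw [← g3] at g9 g10
  generalize t 0 1 1 = n1, t 1 1 1 = n2, t 2 1 1 = n3, t 0 1 2 = l1, t 1 1 2 = l2,
    t 2 1 2 = l3 at g8
  rw [g8] at g9 g10
  have g11 : qe (qt6 n1 n2 n3 l1 l2 l3) = ![r1 / C.det, 0, 0] := by
    rw [f1] at g9
    ext i
    have := congrFun g9 i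
    fin_cases i <;> simp at this ⊢
    · rw [this]; field_simp
    · exact this.resolve_left g2
    · exact this.resolve_left g2
  have g12 : l3 = - n2 := by
    have := congrFun g10 1
    rw [g1, qd_t6 _ _ g11] at this
    simp [g2, c1] at this
    linear_combination this
  subst g12
  refine ⟨R, C, n1, n2, n3, l1, l2, hR, ?_, ?_⟩
  · rw [qe_t6] at g11
    have h1 := congrFun g11 1
    have h2 := congrFun g11 2
    simp at h1 h2
    constructor
    · apply mul_left_cancel₀ (two_ne_zero (α := k))
      linear_combination h1
    · apply mul_left_cancel₀ (two_ne_zero (α := k))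
      linear_combination h2
  · rw [← hT, g3, g8]; rfl

theorem qsign1 (n1 n2 n3 l1 l2 : k) :
    qconj (Matrix.diagonal ![-1, -1, 1]) (qt n1 n2 n3 l1 l2) =
      qmix (Matrix.diagonal ![1, 1, -1]) (qt n1 n2 (-n3) (-l1) (-l2)) := by
  funext i
  ext a b
  fin_cases i <;> fin_cases a <;> fin_cases b <;>
    simp [qconj, qmix, qt, qt6, Matrix.diagonal_transpose, Matrix.mul_diagonal,
      Matrix.diagonal_mul, Fin.sum_univ_three]

theorem qsign2 (n1 n2 n3 l1 l2 : k) :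
    qconj (Matrix.diagonal ![1, -1, -1]) (qt n1 n2 n3 l1 l2) =
      qmix (Matrix.diagonal ![1, -1, -1]) (qt n1 (-n2) (-n3) l1 (-l2)) := by
  funext i
  ext a b
  fin_cases i <;> fin_cases a <;> fin_cases b <;>
    simp [qconj, qmix, qt, qt6, Matrix.diagonal_transpose, Matrix.mul_diagonal,
      Matrix.diagonal_mul, Fin.sum_univ_three]
  all_goals ring

theorem qrot_diag (a b c : k) (ha : a ^ 2 = 1) (hb : b ^ 2 = 1) (hc : c = a * b) :
    qrot (Matrix.diagonal ![a, b, c]) := by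
  subst hc
  apply qrot_of
  · rw [Matrix.diagonal_transpose, Matrix.diagonal_mul_diagonal, ← Matrix.diagonal_one]
    congr 1
    funext i
    fin_cases i <;> simp
    · linear_combination ha
    · linear_combination hb
    · linear_combination b ^ 2 * ha + hb
  · rw [Matrix.det_diagonal]
    simp [Fin.prod_univ_three]
    linear_combination b ^ 2 * ha + hb

def qcan (S : Fin 3 → M3 k) (n1 n2 l1 : k) : Prop :=
  ∃ R C : M3 k, ∃ n3 l2 : k, qrot R ∧ qgood n1 n2 n3 l1 l2 ∧
      qconj R S = qmix C (qt n1 n2 n3 l1 l2)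

theorem qcan_s1 (S : Fin 3 → M3 k) (n1 n2 l1 : k) (h : qcan S n1 n2 l1) :
    qcan S n1 n2 (-l1) := by
  obtain ⟨R, C, n3, l2, hR, hg, h⟩ := h
  refine ⟨Matrix.diagonal ![-1, -1, 1] * R, C * Matrix.diagonal ![1, 1, -1], -n3, -l2,
    qrot_mul (qrot_diag _ _ _ (by ring) (by ring) (by ring)) hR, ?_, ?_⟩
  · obtain ⟨h1, h2⟩ := hg
    exact ⟨by linear_combination h1, by linear_combination -h2⟩
  · rw [← qconj_qconj, h, qconj_mix, qsign1, qmix_mul]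

theorem qcan_s2 (S : Fin 3 → M3 k) (n1 n2 l1 : k) (h : qcan S n1 n2 l1) :
    qcan S n1 (-n2) l1 := by
  obtain ⟨R, C, n3, l2, hR, hg, h⟩ := h
  refine ⟨Matrix.diagonal ![1, -1, -1] * R, C * Matrix.diagonal ![1, -1, -1], -n3, -l2,
    qrot_mul (qrot_diag _ _ _ (by ring) (by ring) (by ring)) hR, ?_, ?_⟩
  · obtain ⟨h1, h2⟩ := hg
    exact ⟨by linear_combination -h1, by linear_combination -h2⟩
  · rw [← qconj_qconj, h, qconj_mix, qsign2, qmix_mul]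

theorem qcan_sq (S : Fin 3 → M3 k) (n1 n2 l1 L M : k) (h : qcan S n1 n2 l1)
    (hL : L ^ 2 = l1 ^ 2) (hM : M ^ 2 = n2 ^ 2) : qcan S n1 M L := by
  rcases sq_eq_sq_iff_eq_or_eq_neg.1 hL with rfl | rfl <;>
  rcases sq_eq_sq_iff_eq_or_eq_neg.1 hM with rfl | rfl
  · exact h
  · exact qcan_s2 _ _ _ _ h
  · exact qcan_s1 _ _ _ _ h
  · exact qcan_s2 _ _ _ _ (qcan_s1 _ _ _ _ h)

theorem qcan_y {S : Fin 3 → M3 k} {R C : M3 k} {n1 n2 n3 l1 l2 : k} (hnd : qnd S ≠ 0)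
    (hR : qrot R) (hg : qgood n1 n2 n3 l1 l2)
    (h : qconj R S = qmix C (qt n1 n2 n3 l1 l2)) (i : Fin 8) :
    qnum S i / qden S i =
    (![n1, l1 ^ 2, n2 ^ 2, (C.transpose * C) 1 1 / (C.transpose * C) 0 0,
      (C.transpose * C) 2 2 / (C.transpose * C) 0 0,
      (C.transpose * C) 0 1 * n2 / (C.transpose * C) 0 0,
      (C.transpose * C) 1 2 * l1 / (C.transpose * C) 0 0,
      (C.transpose * C) 0 2 * l1 * n2 / (C.transpose * C) 0 0] : Fin 8 → k) i := by
  rw [← qnd_conj hR, h] at hnd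
  rw [← (qy_slice C hg hnd i).2, ← qnum_conj hR, ← qden_conj hR, h]

theorem qorbit [IsAlgClosed k] [CharZero k] (S S' : Fin 3 → M3 k) (hS : qsym S) (hS' : qsym S')
    (htr : ∀ i, (S i).trace = 0) (htr' : ∀ i, (S' i).trace = 0) (hnd : qnd S ≠ 0)
    (hnd' : qnd S' ≠ 0) (hy : ∀ i, qnum S i / qden S i = qnum S' i / qden S' i) :
    ∃ R O : M3 k, ∃ t : k, qrot R ∧ qrot O ∧ t ≠ 0 ∧ S' = qmix (t • O) (qconj R S) := by
  obtain ⟨R, C, n1, n2, n3, l1, l2, hR, hg, h⟩ := qcanon S hS htr hnd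
  obtain ⟨R1, C1, n11, n21, n31, l11, l21, hR1, hg1, h1⟩ := qcanon S' hS' htr' hnd'
  have y := qcan_y hnd hR hg h
  have y1 := qcan_y hnd' hR1 hg1 h1
  have a0 : n1 = n11 := by simpa [hy, y1] using (y 0).symm
  have a1 : l1 ^ 2 = l11 ^ 2 := by simpa [hy, y1] using (y 1).symm
  have a2 : n2 ^ 2 = n21 ^ 2 := by simpa [hy, y1] using (y 2).symm
  clear y1
  have hc : qcan S' n1 n2 l1 :=
    qcan_sq _ _ _ _ _ _ ⟨R1, C1, n31, l21, hR1, a0 ▸ hg1, a0 ▸ h1⟩ a1 a2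
  clear hg1 h1 hR1 R1 C1
  obtain ⟨R1, C1, n31, l21, hR1, hg1, h1⟩ := hc
  have y1 := qcan_y hnd' hR1 hg1 h1
  obtain ⟨b1, b2, b3, b4, b5, b6, b7⟩ := (qnd_slice C hg).1 (by rwa [← h, qnd_conj hR])
  obtain ⟨c1, -, -, -, -, -, c7⟩ := (qnd_slice C1 hg1).1 (by rwa [← h1, qnd_conj hR1])
  have d1 : n3 = n31 := by
    apply mul_left_cancel₀ (mul_ne_zero two_ne_zero b4)
    linear_combination hg.1 - hg1.1
  subst d1
  have d2 : l2 = l21 := by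
    apply mul_left_cancel₀ (mul_ne_zero two_ne_zero b6)
    linear_combination hg.2 - hg1.2
  subst d2
  have hN : C1.transpose * C1 =
      ((C1.transpose * C1) 0 0 / (C.transpose * C) 0 0) • (C.transpose * C) := by
    have s : ∀ a b, (C.transpose * C) a b = (C.transpose * C) b a := fun a b => by
      simp [Matrix.mul_apply, Fin.sum_univ_three, mul_comm]
    have s1 : ∀ a b, (C1.transpose * C1) a b = (C1.transpose * C1) b a := fun a b => by
      simp [Matrix.mul_apply, Fin.sum_univ_three, mul_comm]
    have p3 := (y 3).symm
    have p4 := (y 4).symm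
    have p5 := (y 5).symm
    have p6 := (y 6).symm
    have p7 := (y 7).symm
    rw [hy, y1] at p3 p4 p5 p6 p7
    generalize C1.transpose * C1 = N1 at *
    generalize C.transpose * C = N at *
    simp at p3 p4 p5 p6 p7
    field_simp at p3 p4 p5 p6 p7
    ext a b
    simp only [Matrix.smul_apply, smul_eq_mul]
    rw [div_mul_eq_mul_div, eq_div_iff b7]
    fin_cases a <;> fin_cases b <;> simp only [Fin.zero_eta, Fin.mk_one, Fin.reduceFinMk]
    · linear_combination (-1 : k) * p5
    · linear_combination (-1 : k) * p7
    · rw [s1 1 0, s 1 0]; linear_combination (-1 : k) * p5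
    · linear_combination (-1 : k) * p3
    · linear_combination (-1 : k) * p6
    · rw [s1 2 0, s 2 0]; linear_combination (-1 : k) * p7
    · rw [s1 2 1, s 2 1]; linear_combination (-1 : k) * p6
    · linear_combination (-1 : k) * p4
  set s := (C1.transpose * C1) 0 0 / (C.transpose * C) 0 0 with hs
  have hs0 : s ≠ 0 := div_ne_zero c7 b7
  have b1' : IsUnit C.det := isUnit_iff_ne_zero.2 b1
  set A := C1 * C⁻¹ with hA
  have hAA : A.transpose * A = s • 1 := by
    rw [hA, Matrix.transpose_mul]
    calc _ = C⁻¹.transpose * (C1.transpose * C1) * C⁻¹ := by simp only [mul_assoc]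
      _ = s • ((C * C⁻¹).transpose * (C * C⁻¹)) := by
        rw [hN, Matrix.transpose_mul]
        simp only [mul_assoc, smul_mul_assoc, mul_smul_comm]
      _ = _ := by rw [Matrix.mul_nonsing_inv _ b1']; simp
  have hSA : S' = qmix A (qconj (R1.transpose * R) S) := by
    have : qconj R1.transpose (qconj R1 S') = S' := by
      rw [qconj_qconj, hR1.1, qconj_one]
    rw [← qconj_qconj, h, ← this, h1, hA, qconj_mix, qconj_mix, qmix_mul, mul_assoc,
      Matrix.nonsing_inv_mul _ b1', mul_one]
  obtain ⟨t, ht⟩ := IsAlgClosed.exists_pow_nat_eq s (n := 2) (by norm_num)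
  have t0 : t ≠ 0 := by rintro rfl; apply hs0; rw [← ht]; simp
  have key : ∀ t : k, t ^ 2 = s → (t⁻¹ • A).transpose * (t⁻¹ • A) = 1 := by
    intro t ht
    have t0 : t ≠ 0 := by rintro rfl; apply hs0; rw [← ht]; simp
    rw [Matrix.transpose_smul, smul_mul_smul_comm, hAA, smul_smul, ← ht]
    have : t⁻¹ * t⁻¹ * t ^ 2 = 1 := by field_simp
    rw [this, one_smul]
  have hdet : (t⁻¹ • A).det ^ 2 = 1 := by
    have := congrArg Matrix.det (key t ht)
    rw [Matrix.det_mul, Matrix.det_transpose, Matrix.det_one] at this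
    rw [sq, this]
  rcases (sq_eq_sq_iff_eq_or_eq_neg.1 (hdet.trans (one_pow 2).symm)) with hd | hd
  · refine ⟨R1.transpose * R, t⁻¹ • A, t, qrot_mul (qrot_tr hR1) hR, qrot_of (key t ht) hd, t0, ?_⟩
    rw [smul_smul, mul_inv_cancel₀ t0, one_smul]; exact hSA
  · refine ⟨R1.transpose * R, (-t)⁻¹ • A, -t, qrot_mul (qrot_tr hR1) hR,
      qrot_of (key (-t) (by rw [← ht]; ring)) ?_, neg_ne_zero.2 t0, ?_⟩
    · rw [Matrix.det_smul] at hd ⊢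
      simp only [Fintype.card_fin, inv_neg] at hd ⊢
      linear_combination (-1 : k) * hd
    · rw [smul_smul, mul_inv_cancel₀ (neg_ne_zero.2 t0), one_smul]; exact hSA

end canon

section rep
variable {k : Type*} [CommRing k]

def rho2 (g : Matrix (Fin 2) (Fin 2) k) : M3 k :=
  !![g 1 1 ^ 2, g 0 1 * g 1 1, g 0 1 ^ 2;
    2 * g 1 0 * g 1 1, g 0 1 * g 1 0 + g 0 0 * g 1 1, 2 * g 0 0 * g 0 1;
    g 1 0 ^ 2, g 0 0 * g 1 0, g 0 0 ^ 2]

def rho4 (g : Matrix (Fin 2) (Fin 2) k) : Matrix (Fin 5) (Fin 5) k :=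
  !![g 1 1 ^ 4, g 0 1 * g 1 1 ^ 3, g 0 1 ^ 2 * g 1 1 ^ 2, g 0 1 ^ 3 * g 1 1, g 0 1 ^ 4;
    4 * g 1 0 * g 1 1 ^ 3, 3 * g 0 1 * g 1 0 * g 1 1 ^ 2 + g 0 0 * g 1 1 ^ 3, 2 * g 0 1 ^ 2 * g 1 0 * g 1 1 + 2 * g 0 0 * g 0 1 * g 1 1 ^ 2, g 0 1 ^ 3 * g 1 0 + 3 * g 0 0 * g 0 1 ^ 2 * g 1 1, 4 * g 0 0 * g 0 1 ^ 3;
    6 * g 1 0 ^ 2 * g 1 1 ^ 2, 3 * g 0 1 * g 1 0 ^ 2 * g 1 1 + 3 * g 0 0 * g 1 0 * g 1 1 ^ 2, g 0 1 ^ 2 * g 1 0 ^ 2 + 4 * g 0 0 * g 0 1 * g 1 0 * g 1 1 + g 0 0 ^ 2 * g 1 1 ^ 2, 3 * g 0 0 * g 0 1 ^ 2 * g 1 0 + 3 * g 0 0 ^ 2 * g 0 1 * g 1 1, 6 * g 0 0 ^ 2 * g 0 1 ^ 2;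
    4 * g 1 0 ^ 3 * g 1 1, g 0 1 * g 1 0 ^ 3 + 3 * g 0 0 * g 1 0 ^ 2 * g 1 1, 2 * g 0 0 * g 0 1 * g 1 0 ^ 2 + 2 * g 0 0 ^ 2 * g 1 0 * g 1 1, 3 * g 0 0 ^ 2 * g 0 1 * g 1 0 + g 0 0 ^ 3 * g 1 1, 4 * g 0 0 ^ 3 * g 0 1;
    g 1 0 ^ 4, g 0 0 * g 1 0 ^ 3, g 0 0 ^ 2 * g 1 0 ^ 2, g 0 0 ^ 3 * g 1 0, g 0 0 ^ 4]

def qT (x : Fin 5 → k) : M3 k :=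
  !![6 * x 0, 3 * x 1, x 2; 3 * x 1, 4 * x 2, 3 * x 3; x 2, 3 * x 3, 6 * x 4]

set_option maxRecDepth 4000 in
theorem qT_act (h : Matrix (Fin 2) (Fin 2) k) (x : Fin 5 → k) :
    qT ((rho4 h).mulVec x) = rho2 h * qT x * (rho2 h).transpose := by
  ext i j
  fin_cases i <;> fin_cases j <;>
    simp [qT, rho4, rho2, Matrix.mul_apply, Matrix.mulVec, dotProduct, Fin.sum_univ_succ] <;> ring

def qact (g h : Matrix (Fin 2) (Fin 2) k) (x : Fin 3 × Fin 5 → k) : Fin 3 × Fin 5 → k :=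
  fun p => ∑ q, rho2 g p.1 q.1 * rho4 h p.2 q.2 * x q

def qTx (x : Fin 3 × Fin 5 → k) : Fin 3 → M3 k := fun a => qT (fun b => x (a, b))

theorem qT_sum (c : Fin 3 → k) (y : Fin 3 → Fin 5 → k) :
    qT (∑ i, c i • y i) = ∑ i, c i • qT (y i) := by
  ext i j
  fin_cases i <;> fin_cases j <;> simp [qT, Fin.sum_univ_three] <;> ring

theorem qTx_act (g h : Matrix (Fin 2) (Fin 2) k) (x : Fin 3 × Fin 5 → k) :
    qTx (qact g h x) = qmix (rho2 g) (qconj (rho2 h) (qTx x)) := by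
  funext a
  simp only [qmix, qconj, qTx, ← qT_act]
  rw [← qT_sum]
  congr 1
  funext b
  simp only [qact, Fintype.sum_prod_type, Finset.sum_apply, Pi.smul_apply, Matrix.mulVec,
    dotProduct, smul_eq_mul, Finset.mul_sum, mul_assoc]

theorem rho2_smul (s : k) (g : Matrix (Fin 2) (Fin 2) k) : rho2 (s • g) = s ^ 2 • rho2 g := by
  ext i j
  fin_cases i <;> fin_cases j <;> simp [rho2] <;> ring

theorem rho2_det (g : Matrix (Fin 2) (Fin 2) k) : (rho2 g).det = g.det ^ 3 := by
  rw [Matrix.det_fin_three, Matrix.det_fin_two]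
  simp [rho2]; ring

def qJ : M3 k := !![0, 0, -2; 0, 1, 0; -2, 0, 0]

theorem rho2_J (g : Matrix (Fin 2) (Fin 2) k) :
    (rho2 g).transpose * qJ * rho2 g = g.det ^ 2 • qJ := by
  ext i j
  rw [Matrix.det_fin_two]
  fin_cases i <;> fin_cases j <;>
    simp [qJ, rho2, Matrix.mul_apply, Fin.sum_univ_succ] <;> ring

end rep

theorem coeff_bin (d : ℕ) (r : Fin (d + 1) → ℂ) (i : Fin (d + 1)) :
    coeff (Finsupp.single 0 (i : ℕ) + Finsupp.single 1 (d - (i : ℕ)))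
      (∑ a : Fin (d + 1), C (r a) * (X 0 ^ (a : ℕ) * X 1 ^ (d - (a : ℕ))) :
        MvPolynomial (Fin 2) ℂ) = r i := by
  rw [coeff_sum, Finset.sum_eq_single i]
  · rw [X_pow_eq_monomial, X_pow_eq_monomial, monomial_mul, coeff_C_mul, coeff_monomial]
    simp
  · intro b _ hb
    rw [X_pow_eq_monomial, X_pow_eq_monomial, monomial_mul, coeff_C_mul, coeff_monomial, if_neg]
    · simp
    · intro h
      have := DFunLike.congr_fun h 0
      simp at this
      exact hb (Fin.ext this)
  · simp

theorem repMat2 (g : SL2) : repMat 2 g = rho2 g.1 := by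
  funext i j
  have c2 : (C 2 : MvPolynomial (Fin 2) ℂ) = 2 := map_ofNat C 2
  have c3 : (C 3 : MvPolynomial (Fin 2) ℂ) = 3 := map_ofNat C 3
  have c4 : (C 4 : MvPolynomial (Fin 2) ℂ) = 4 := map_ofNat C 4
  have c6 : (C 6 : MvPolynomial (Fin 2) ℂ) = 6 := map_ofNat C 6
  have : sub1 g (X 0 ^ (j : ℕ) * X 1 ^ (2 - (j : ℕ))) =
      ∑ a : Fin (2 + 1), C (rho2 g.1 a j) * (X 0 ^ (a : ℕ) * X 1 ^ (2 - (a : ℕ))) := by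
    fin_cases j <;> simp [sub1, Fin.sum_univ_succ, rho2, c2] <;> ring
  rw [repMat, this, coeff_bin]

theorem repMat4 (g : SL2) : repMat 4 g = rho4 g.1 := by
  funext i j
  have c2 : (C 2 : MvPolynomial (Fin 2) ℂ) = 2 := map_ofNat C 2
  have c3 : (C 3 : MvPolynomial (Fin 2) ℂ) = 3 := map_ofNat C 3
  have c4 : (C 4 : MvPolynomial (Fin 2) ℂ) = 4 := map_ofNat C 4
  have c6 : (C 6 : MvPolynomial (Fin 2) ℂ) = 6 := map_ofNat C 6
  have : sub1 g (X 0 ^ (j : ℕ) * X 1 ^ (4 - (j : ℕ))) =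
      ∑ a : Fin (4 + 1), C (rho4 g.1 a j) * (X 0 ^ (a : ℕ) * X 1 ^ (4 - (a : ℕ))) := by
    fin_cases j <;> simp [sub1, Fin.sum_univ_succ, rho4, c2, c3, c4, c6] <;> ring
  rw [repMat, this, coeff_bin]

def cQ : M3 ℂ := !![0, 1, 0; -Complex.I, 0, -Complex.I; -1, 0, 1]
def cQi : M3 ℂ := !![0, Complex.I / 2, -1 / 2; 1, 0, 0; 0, Complex.I / 2, 1 / 2]

theorem cQ1 : cQ * cQi = 1 := by
  ext i j
  fin_cases i <;> fin_cases j <;> simp [cQ, cQi, Matrix.mul_apply, Fin.sum_univ_three]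
  · linear_combination (-1 : ℂ) * Complex.I_sq
  · ring
  · ring

theorem cQ2 : cQi * cQ = 1 := mul_eq_one_comm.1 cQ1

theorem cQJ : cQ.transpose * cQ = qJ := by
  ext i j
  fin_cases i <;> fin_cases j <;> simp [cQ, qJ, Matrix.mul_apply, Fin.sum_univ_three]
  all_goals ring

theorem qT_sym {k : Type*} [CommRing k] (x : Fin 5 → k) : (qT x).transpose = qT x := by
  ext i j
  fin_cases i <;> fin_cases j <;> simp [qT]

section equi
variable (k : Type*) [CommRing k] [Algebra ℂ k]

def qQ : M3 k := cQ.map (algebraMap ℂ k)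
def qQi : M3 k := cQi.map (algebraMap ℂ k)

theorem qQ1 : qQ k * qQi k = 1 := by
  rw [qQ, qQi, ← Matrix.map_mul, cQ1, Matrix.map_one _ (map_zero _) (map_one _)]

theorem qQ2 : qQi k * qQ k = 1 := mul_eq_one_comm.1 (qQ1 k)

theorem qQJ : (qQ k).transpose * qQ k = qJ := by
  rw [qQ, ← Matrix.transpose_map, ← Matrix.map_mul, cQJ]
  ext i j
  fin_cases i <;> fin_cases j <;> simp [qJ]
  all_goals exact map_ofNat _ 2

variable {k}

def qL (x : Fin 3 × Fin 5 → k) : Fin 3 → M3 k := qmix (qQ k) (qconj (qQ k) (qTx x))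

def qO (g : Matrix (Fin 2) (Fin 2) k) : M3 k := qQ k * rho2 g * qQi k

theorem qTx_L (x : Fin 3 × Fin 5 → k) : qTx x = qmix (qQi k) (qconj (qQi k) (qL x)) := by
  rw [qL, qconj_mix, qconj_qconj, qmix_mul, qQ2, qconj_one, qmix_one]

theorem qL_act (g h : Matrix (Fin 2) (Fin 2) k) (x : Fin 3 × Fin 5 → k) :
    qL (qact g h x) = qmix (qO g) (qconj (qO h) (qL x)) := by
  simp only [qL, qTx_act, qO, qconj_mix, qconj_qconj, qmix_mul, mul_assoc, qQ2, mul_one]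

theorem qO_tr (g : Matrix (Fin 2) (Fin 2) k) :
    (qO g).transpose * qO g = g.det ^ 2 • 1 := by
  have h1 : (qQi k).transpose * qJ * qQi k = 1 := by
    rw [← qQJ k]
    calc _ = (qQ k * qQi k).transpose * (qQ k * qQi k) := by
          simp only [Matrix.transpose_mul, mul_assoc]
      _ = 1 := by rw [qQ1]; simp
  calc _ = (qQi k).transpose * ((rho2 g).transpose * ((qQ k).transpose * qQ k) * rho2 g) *
        qQi k := by simp only [qO, Matrix.transpose_mul, mul_assoc]
    _ = _ := by rw [qQJ, rho2_J, mul_smul_comm, smul_mul_assoc, h1]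

theorem qO_det (g : Matrix (Fin 2) (Fin 2) k) : (qO g).det = g.det ^ 3 := by
  have := congrArg Matrix.det (qQ1 k)
  rw [Matrix.det_mul, Matrix.det_one] at this
  rw [qO, Matrix.det_mul, Matrix.det_mul, rho2_det]
  linear_combination g.det ^ 3 * this

theorem qO_rot (g : Matrix (Fin 2) (Fin 2) k) (hg : g.det = 1) : qrot (qO g) := by
  apply qrot_of
  · rw [qO_tr, hg]; simp
  · rw [qO_det, hg]; simp

theorem qL_sym (x : Fin 3 × Fin 5 → k) : qsym (qL x) :=
  qsym_mix _ _ (qsym_conj _ _ fun _ => qT_sym _)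

theorem qL_trace (x : Fin 3 × Fin 5 → k) (i : Fin 3) : (qL x i).trace = 0 := by
  apply qmix_trace
  intro i
  rw [qconj, Matrix.trace_mul_comm, ← mul_assoc, qQJ, Matrix.trace_fin_three]
  simp [qJ, qTx, qT, Matrix.mul_apply, Fin.sum_univ_three]
  ring

theorem qL_smul (t : k) (x : Fin 3 × Fin 5 → k) : qL (t • x) = qmix (t • 1) (qL x) := by
  have : qTx (t • x) = qmix (t • 1) (qTx x) := by
    funext a
    ext i j
    fin_cases i <;> fin_cases j <;>
      simp [qTx, qT, qmix, Matrix.one_apply] <;> ring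
  rw [qL, this, qconj_mix, qmix_mul, qL, qmix_mul]
  simp

end equi

theorem qL_map {k l : Type*} [CommRing k] [Algebra ℂ k] [CommRing l] [Algebra ℂ l]
    (φ : k →ₐ[ℂ] l) (x : Fin 3 × Fin 5 → k) :
    qL (φ ∘ x) = qmap φ.toRingHom (qL x) := by
  have hT : qTx (φ ∘ x) = qmap φ.toRingHom (qTx x) := by
    have c3 : φ 3 = 3 := map_ofNat φ 3
    have c4 : φ 4 = 4 := map_ofNat φ 4
    have c6 : φ 6 = 6 := map_ofNat φ 6
    funext a
    ext i j
    fin_cases i <;> fin_cases j <;> simp [qTx, qT, qmap, c3, c4, c6]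
  have hQ : qQ l = (qQ k).map φ := by
    ext i j
    simp [qQ]
  rw [qL, hT, hQ]
  funext a
  ext i j
  simp [qL, qmix, qconj, qmap, Matrix.mul_apply, Fin.sum_univ_three]

section surj
variable {k : Type*} [Field k] [Algebra ℂ k]

theorem qT_inj (x y : Fin 5 → k) (h : qT x = qT y) : x = y := by
  have : CharZero k := charZero_of_injective_algebraMap (algebraMap ℂ k).injective
  funext i
  have a := fun i j => congrFun (congrFun h i) j
  have a0 := a 0 0
  have a1 := a 0 1
  have a2 := a 0 2
  have a3 := a 1 2
  have a4 := a 2 2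
  simp [qT] at a0 a1 a2 a3 a4
  fin_cases i <;> simp [*]

theorem qL_inj (x y : Fin 3 × Fin 5 → k) (h : qL x = qL y) : x = y := by
  have h1 : qTx x = qTx y := by rw [qTx_L, h, ← qTx_L]
  funext p
  exact congrFun (qT_inj _ _ (congrFun h1 p.1)) p.2

theorem qL_surj (S : Fin 3 → M3 k) (hS : qsym S) (ht : ∀ i, (S i).trace = 0) :
    ∃ x : Fin 3 × Fin 5 → k, qL x = S := by
  have : CharZero k := charZero_of_injective_algebraMap (algebraMap ℂ k).injective
  set W := qmix (qQi k) (qconj (qQi k) S) with hW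
  have hWS : S = qmix (qQ k) (qconj (qQ k) W) := by
    rw [hW, qconj_mix, qconj_qconj, qmix_mul, qQ1, qconj_one, qmix_one]
  have hs : qsym W := qsym_mix _ _ (qsym_conj _ _ hS)
  have hJ : ∀ i, (W i).trace = (W i).trace ∧ W i 1 1 = 4 * W i 0 2 := by
    intro i
    refine ⟨rfl, ?_⟩
    have hQS : qmix (qQi k) S = qconj (qQ k) W := by
      rw [hWS, qmix_mul, qQ2, qmix_one]
    have h2 : (qconj (qQ k) W i).trace = 0 := by
      rw [← hQS]; exact qmix_trace _ _ ht i
    rw [qconj, Matrix.trace_mul_comm, ← mul_assoc, qQJ, Matrix.trace_fin_three] at h2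
    have h3 : W i 2 0 = W i 0 2 := congrFun (congrFun (hs i) 0) 2
    simp [qJ, Matrix.mul_apply, Fin.sum_univ_three] at h2
    rw [h3] at h2
    linear_combination h2
  refine ⟨fun p => ![W p.1 0 0 / 6, W p.1 0 1 / 3, W p.1 0 2, W p.1 1 2 / 3, W p.1 2 2 / 6] p.2, ?_⟩
  rw [hWS, qL]
  congr 2
  funext a
  have s : ∀ i j, W a i j = W a j i := fun i j => congrFun (congrFun (hs a) j) i
  ext i j
  fin_cases i <;> fin_cases j <;> simp [qTx, qT, (hJ a).2, s 1 0, s 2 0, s 2 1]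
  all_goals field_simp

theorem qN_rep (N : M3 k) (hJ : N.transpose * qJ * N = qJ) (hd : N.det = 1) :
    ∃ (g : Matrix (Fin 2) (Fin 2) k) (c : k), c ≠ 0 ∧ rho2 g = c • N := by
  have : CharZero k := charZero_of_injective_algebraMap (algebraMap ℂ k).injective
  -- the inverse transpose relation
  have hc : qJ * N = qcrs N * qJ := by
    have h1 := qcrs_tr2 N.transpose
    rw [Matrix.det_transpose, hd, one_smul, qcrs_transpose, Matrix.transpose_transpose,
      mul_eq_one_comm] at h1
    calc qJ * N = (qcrs N * N.transpose) * qJ * N := by rw [h1, one_mul]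
      _ = qcrs N * (N.transpose * qJ * N) := by simp only [mul_assoc]
      _ = _ := by rw [hJ]
  have e := fun i j => congrFun (congrFun hc i) j
  have f := fun i j => congrFun (congrFun hJ i) j
  simp only [Matrix.mul_apply, Fin.sum_univ_three, qcrs, qcr, qJ, Matrix.transpose_apply] at e f
  have hp : N * !![0, 0, -1; 0, 2, 0; -1, 0, 0] * N.transpose =
      (!![0, 0, -1; 0, 2, 0; -1, 0, 0] : M3 k) := by
    have hJJ : (!![0, 0, -1; 0, 2, 0; -1, 0, 0] : M3 k) * qJ = (2 : k) • 1 := by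
      ext i j
      fin_cases i <;> fin_cases j <;> simp [qJ, Matrix.mul_apply, Fin.sum_univ_three]
    generalize (!![0, 0, -1; 0, 2, 0; -1, 0, 0] : M3 k) = J2 at *
    have h1 : ((2 : k)⁻¹ • (J2 * N.transpose * qJ)) * N = 1 := by
      rw [smul_mul_assoc, mul_assoc, mul_assoc, ← mul_assoc N.transpose, hJ, hJJ, smul_smul]
      simp
    have h2 := mul_eq_one_comm.1 h1
    have h3 : qJ * J2 = (2 : k) • (1 : M3 k) := by
      have : ((2 : k)⁻¹ • J2) * qJ = 1 := by rw [smul_mul_assoc, hJJ, smul_smul]; simp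
      have := mul_eq_one_comm.1 this
      rw [mul_smul_comm] at this
      rw [← this, smul_smul]; simp
    calc _ = (N * ((2 : k)⁻¹ • (J2 * N.transpose * qJ))) * J2 := by
          rw [mul_smul_comm, smul_mul_assoc]
          have : N * (J2 * N.transpose * qJ) * J2 = N * J2 * N.transpose * (qJ * J2) := by
            simp only [mul_assoc]
          rw [this, h3, mul_smul_comm, smul_smul]
          simp
      _ = J2 := by rw [h2, one_mul]
  have p := fun i j => congrFun (congrFun hp i) j
  simp only [Matrix.mul_apply, Fin.sum_univ_three, Matrix.transpose_apply] at p
  have p00 := p 0 0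
  have p01 := p 0 1
  have p11 := p 1 1
  have p12 := p 1 2
  have p22 := p 2 2
  have e00 := e 0 0
  have e01 := e 0 1
  have e02 := e 0 2
  have e10 := e 1 0
  have e11 := e 1 1
  have e12 := e 1 2
  have e20 := e 2 0
  have e21 := e 2 1
  have e22 := e 2 2
  have f00 := f 0 0
  have f01 := f 0 1
  have f02 := f 0 2
  have f11 := f 1 1
  have f12 := f 1 2
  have f22 := f 2 2
  simp at e00 e01 e02 e10 e11 e12 e20 e21 e22 f00 f01 f02 f11 f12 f22 p00 p01 p11 p12 p22
  clear e f p hp hc hJ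
  by_cases h22 : N 2 2 = 0
  · have h02 : N 0 2 ≠ 0 := by
      intro h02
      rw [h22, h02] at f22
      have h12 : N 1 2 = 0 := by simpa using f22
      rw [Matrix.det_fin_three, h22, h02, h12] at hd
      simp at hd
    refine ⟨!![N 1 2 / 2, N 0 2; (N 1 1 - 1) / 2, N 0 1], N 0 2, h02, ?_⟩
    ext i j
    fin_cases i <;> fin_cases j <;> simp [rho2]
    all_goals first
      | ring1
      | linear_combination (1 / 2 : k) * p00
      | linear_combination (1 / 2 : k) * p01 - (1 / 2 : k) * e21
      | linear_combination (1 / 2 : k) * p01 + (1 / 2 : k) * e21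
      | linear_combination (1 / 4 : k) * e22
      | linear_combination (-1 / 4 : k) * e22
      | linear_combination (1 / 4 : k) * f02 + (1 / 2 : k) * e11 + (1 / 8 : k) * p11
      | linear_combination (1 / 4 : k) * f02 - (1 / 2 : k) * e11 + (1 / 8 : k) * p11
      | linear_combination (1 / 4 : k) * f12 - (1 / 4 : k) * e12
      | linear_combination (1 / 4 : k) * f22
  · refine ⟨!![N 2 2, N 1 2 / 2; N 2 1, (N 1 1 + 1) / 2], N 2 2, h22, ?_⟩
    ext i j
    fin_cases i <;> fin_cases j <;> simp [rho2]
    all_goals first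
      | ring1
      | linear_combination (1 / 4 : k) * f02 + (1 / 2 : k) * e11 + (1 / 8 : k) * p11
      | linear_combination (1 / 4 : k) * f02 - (1 / 2 : k) * e11 + (1 / 8 : k) * p11
      | linear_combination (1 / 4 : k) * f12 + (1 / 4 : k) * e12
      | linear_combination (1 / 4 : k) * f22
      | linear_combination (1 / 2 : k) * p12 - (1 / 2 : k) * e01
      | linear_combination (1 / 2 : k) * p12 + (1 / 2 : k) * e01
      | linear_combination (1 / 4 : k) * e02
      | linear_combination (-1 / 4 : k) * e02
      | linear_combination (1 / 2 : k) * p22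

end surj

section orbx
variable {k : Type*} [Field k] [Algebra ℂ k]

theorem qO_surj (O : M3 k) (hO : qrot O) :
    ∃ (g : Matrix (Fin 2) (Fin 2) k) (c : k), c ≠ 0 ∧ qO g = c • O := by
  have h1 : (qQi k).transpose * qJ * qQi k = 1 := by
    rw [← qQJ k]
    calc _ = (qQ k * qQi k).transpose * (qQ k * qQi k) := by
          simp only [Matrix.transpose_mul, mul_assoc]
      _ = 1 := by rw [qQ1]; simp
  have hdQ := congrArg Matrix.det (qQ1 k)
  rw [Matrix.det_mul, Matrix.det_one] at hdQ
  obtain ⟨g, c, hc, h⟩ := qN_rep (qQi k * O * qQ k) (by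
    calc _ = (qQ k).transpose * (O.transpose * ((qQi k).transpose * qJ * qQi k) * O) * qQ k := by
          simp only [Matrix.transpose_mul, mul_assoc]
      _ = _ := by rw [h1, mul_one, hO.1, mul_one, qQJ]) (by
    rw [Matrix.det_mul, Matrix.det_mul, qrot_det hO]; linear_combination hdQ)
  refine ⟨g, c, hc, ?_⟩
  rw [qO, h, mul_smul_comm, smul_mul_assoc]
  congr 1
  calc _ = (qQ k * qQi k) * O * (qQ k * qQi k) := by simp only [mul_assoc]
    _ = O := by rw [qQ1]; simp

theorem qorbit_x [IsAlgClosed k] (x x' : Fin 3 × Fin 5 → k)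
    (hnd : qnd (qL x) ≠ 0) (hnd' : qnd (qL x') ≠ 0)
    (hy : ∀ i, qnum (qL x) i / qden (qL x) i = qnum (qL x') i / qden (qL x') i) :
    ∃ g h : Matrix (Fin 2) (Fin 2) k, x' = qact g h x := by
  have : CharZero k := charZero_of_injective_algebraMap (algebraMap ℂ k).injective
  obtain ⟨R, O, t, hR, hO, ht, hS⟩ := qorbit (qL x) (qL x') (qL_sym x) (qL_sym x') (qL_trace x)
    (qL_trace x') hnd hnd' hy
  obtain ⟨g, c, hc, hg⟩ := qO_surj O hO
  obtain ⟨h, d, hd, hh⟩ := qO_surj R hR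
  obtain ⟨s, hs⟩ := IsAlgClosed.exists_pow_nat_eq (t / (c * d ^ 2)) (n := 2) (by norm_num)
  refine ⟨s • g, h, ?_⟩
  apply qL_inj
  rw [qL_act, hS, hh]
  have h1 : qO (s • g) = (t / d ^ 2) • O := by
    rw [qO, rho2_smul, hs, mul_smul_comm, smul_mul_assoc, ← qO, hg, smul_smul]
    congr 1
    field_simp
  have h2 : qconj (d • R) (qL x) = qmix (d ^ 2 • 1) (qconj R (qL x)) := by
    funext i
    ext a b
    simp [qconj, qmix, Matrix.one_apply, Matrix.transpose_smul]
    ring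
  rw [h1, h2, qmix_mul]
  congr 1
  rw [smul_mul_smul_comm, mul_one]
  congr 1
  field_simp

end orbx

section dens

theorem rho2_map {k l : Type*} [CommRing k] [CommRing l] (φ : k →+* l)
    (g : Matrix (Fin 2) (Fin 2) k) : rho2 (g.map φ) = (rho2 g).map φ := by
  have c2 : φ 2 = 2 := map_ofNat φ 2
  ext i j
  fin_cases i <;> fin_cases j <;> simp [rho2, c2]

theorem rho4_map {k l : Type*} [CommRing k] [CommRing l] (φ : k →+* l)
    (g : Matrix (Fin 2) (Fin 2) k) : rho4 (g.map φ) = (rho4 g).map φ := by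
  have c2 : φ 2 = 2 := map_ofNat φ 2
  have c3 : φ 3 = 3 := map_ofNat φ 3
  have c4 : φ 4 = 4 := map_ofNat φ 4
  have c6 : φ 6 = 6 := map_ofNat φ 6
  ext i j
  fin_cases i <;> fin_cases j <;> simp [rho4, c2, c3, c4, c6]

theorem qact_map {k l : Type*} [CommRing k] [CommRing l] (φ : k →+* l)
    (g h : Matrix (Fin 2) (Fin 2) k) (x : Fin 3 × Fin 5 → k) :
    qact (g.map φ) (h.map φ) (φ ∘ x) = φ ∘ qact g h x := by
  funext p
  simp [qact, rho2_map, rho4_map]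

theorem rho4_smul {k : Type*} [CommRing k] (s : k) (g : Matrix (Fin 2) (Fin 2) k) :
    rho4 (s • g) = s ^ 4 • rho4 g := by
  ext i j
  fin_cases i <;> fin_cases j <;> simp [rho4] <;> ring

theorem qact_smul {k : Type*} [CommRing k] (s r : k) (g h : Matrix (Fin 2) (Fin 2) k)
    (x : Fin 3 × Fin 5 → k) :
    qact (s • g) (r • h) x = (s ^ 2 * r ^ 4) • qact g h x := by
  funext p
  simp only [qact, rho2_smul, rho4_smul, Matrix.smul_apply, Pi.smul_apply, smul_eq_mul,
    Finset.mul_sum]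
  refine Finset.sum_congr rfl fun q _ => ?_
  ring

theorem coordHom_eq (g h : SL2) (t : ℂˣ) (f : MvPolynomial (Fin 3 × Fin 5) ℂ)
    {k : Type*} [CommRing k] [Algebra ℂ k] (x : Fin 3 × Fin 5 → k) :
    aeval x (coordHomAB 2 4 g h t f) =
      aeval (algebraMap ℂ k t • qact (g.1.map (algebraMap ℂ k)) (h.1.map (algebraMap ℂ k)) x) f := by
  have : (aeval x).comp (coordHomAB 2 4 g h t) =
      aeval (algebraMap ℂ k t • qact (g.1.map (algebraMap ℂ k)) (h.1.map (algebraMap ℂ k)) x) := by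
    apply algHom_ext
    intro p
    rw [AlgHom.comp_apply, coordHomAB, aeval_X, aeval_X, map_smul, Algebra.smul_def, Pi.smul_apply,
      smul_eq_mul, qact, map_sum]
    congr 1
    refine Finset.sum_congr rfl fun q _ => ?_
    rw [map_mul, aeval_C, aeval_X, map_mul, repMat2, repMat4, rho2_map, rho4_map]
    rfl
  exact DFunLike.congr_fun this f

theorem sl_norm (g : Matrix (Fin 2) (Fin 2) ℂ) (hg : g.det ≠ 0) :
    ∃ (s : ℂ) (g1 : SL2), s ≠ 0 ∧ g = s • g1.1 := by
  obtain ⟨s, hs⟩ := IsAlgClosed.exists_pow_nat_eq g.det (n := 2) (by norm_num)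
  have s0 : s ≠ 0 := by rintro rfl; apply hg; rw [← hs]; simp
  refine ⟨s, ⟨s⁻¹ • g, ?_⟩, s0, ?_⟩
  · rw [Matrix.det_smul, ← hs]; simp; field_simp
  · simp [smul_smul, s0]

theorem dens_C (f g : MvPolynomial (Fin 3 × Fin 5) ℂ)
    (hfg : ∀ γ : SL2 × SL2 × ℂˣ, coordHomAB 2 4 γ.1 γ.2.1 γ.2.2 f * g =
      coordHomAB 2 4 γ.1 γ.2.1 γ.2.2 g * f)
    (a b : Matrix (Fin 2) (Fin 2) ℂ) (ha : a.det ≠ 0) (hb : b.det ≠ 0) (x : Fin 3 × Fin 5 → ℂ) :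
    aeval (qact a b x) f * aeval x g = aeval (qact a b x) g * aeval x f := by
  obtain ⟨s, a, s0, rfl⟩ := sl_norm a ha
  obtain ⟨r, b, r0, rfl⟩ := sl_norm b hb
  have h := congrArg (aeval x) (hfg (a, b, Units.mk0 (s ^ 2 * r ^ 4)
    (mul_ne_zero (pow_ne_zero _ s0) (pow_ne_zero _ r0))))
  simp only [map_mul, coordHom_eq] at h
  have e : ∀ m : Matrix (Fin 2) (Fin 2) ℂ, m.map (algebraMap ℂ ℂ) = m := fun m => rfl
  rw [e, e] at h
  rw [qact_smul]
  exact h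

abbrev qBig := (Fin 2 × Fin 2) ⊕ (Fin 2 × Fin 2) ⊕ (Fin 3 × Fin 5)

theorem qkey {m l : Type*} [CommRing m] [Algebra ℂ m] [CommRing l] [Algebra ℂ l] (φ : m →ₐ[ℂ] l)
    (A B : Matrix (Fin 2) (Fin 2) m) (Y : Fin 3 × Fin 5 → m) (f : MvPolynomial (Fin 3 × Fin 5) ℂ) :
    φ (aeval (qact A B Y) f) = aeval (qact (A.map φ) (B.map φ) (φ ∘ Y)) f := by
  have h1 := qact_map φ.toRingHom A B Y
  simp only [AlgHom.toRingHom_eq_coe, RingHom.coe_coe] at h1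
  rw [h1, ← AlgHom.comp_apply, comp_aeval]
  rfl

theorem qkey2 {m l : Type*} [CommRing m] [Algebra ℂ m] [CommRing l] [Algebra ℂ l] (φ : m →ₐ[ℂ] l)
    (Y : Fin 3 × Fin 5 → m) (f : MvPolynomial (Fin 3 × Fin 5) ℂ) :
    φ (aeval Y f) = aeval (φ ∘ Y) f := by
  rw [← AlgHom.comp_apply, comp_aeval]
  rfl

theorem dens (f g : MvPolynomial (Fin 3 × Fin 5) ℂ)
    (hfg : ∀ γ : SL2 × SL2 × ℂˣ, coordHomAB 2 4 γ.1 γ.2.1 γ.2.2 f * g =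
      coordHomAB 2 4 γ.1 γ.2.1 γ.2.2 g * f)
    {k : Type*} [CommRing k] [Algebra ℂ k]
    (a b : Matrix (Fin 2) (Fin 2) k) (x : Fin 3 × Fin 5 → k) :
    aeval (qact a b x) f * aeval x g = aeval (qact a b x) g * aeval x f := by
  let A : Matrix (Fin 2) (Fin 2) (MvPolynomial qBig ℂ) := Matrix.of fun i j => X (Sum.inl (i, j))
  let B : Matrix (Fin 2) (Fin 2) (MvPolynomial qBig ℂ) :=
    Matrix.of fun i j => X (Sum.inr (Sum.inl (i, j)))
  let Y : Fin 3 × Fin 5 → MvPolynomial qBig ℂ := fun p => X (Sum.inr (Sum.inr p))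
  have main : aeval (qact A B Y) f * aeval Y g - aeval (qact A B Y) g * aeval Y f = 0 := by
    have h0 : (aeval (qact A B Y) f * aeval Y g - aeval (qact A B Y) g * aeval Y f) *
        (A.det * B.det) = 0 := by
      apply MvPolynomial.funext
      intro v
      rw [map_zero, ← coe_aeval_eq_eval, RingHom.coe_coe, map_mul, map_sub, map_mul, map_mul,
        qkey, qkey, qkey2, qkey2, map_mul, AlgHom.map_det, AlgHom.map_det]
      by_cases h1 : (A.map (aeval v)).det = 0
      · simp only [AlgHom.mapMatrix_apply]; rw [h1]; ring
      by_cases h2 : (B.map (aeval v)).det = 0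
      · simp only [AlgHom.mapMatrix_apply]; rw [h2]; ring
      rw [dens_C f g hfg _ _ h1 h2]; ring
    refine (mul_eq_zero.1 h0).resolve_right ?_
    intro h
    have := congrArg (aeval (fun v : qBig => Sum.elim (fun p : Fin 2 × Fin 2 =>
      (1 : Matrix (Fin 2) (Fin 2) ℂ) p.1 p.2) (Sum.elim (fun p : Fin 2 × Fin 2 =>
      (1 : Matrix (Fin 2) (Fin 2) ℂ) p.1 p.2) (fun _ => 0)) v)) h
    simp [A, B, Matrix.det_fin_two] at this
  have := congrArg (aeval (fun v : qBig => Sum.elim (fun p : Fin 2 × Fin 2 =>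
      a p.1 p.2) (Sum.elim (fun p : Fin 2 × Fin 2 => b p.1 p.2) x) v)) main
  rw [map_zero, map_sub, map_mul, map_mul, qkey, qkey, qkey2, qkey2, sub_eq_zero] at this
  convert this using 4 <;>
  first
  | (congr 1 <;> first | (ext i j; simp [A, B, Y]) | (ext i; simp [A, B, Y]))
  | (ext i; simp [A, B, Y])

end dens

section embs

open TensorProduct in
theorem amalg {E K L : Type} [Field E] [Field K] [Field L] (a : E →+* K) (b : E →+* L) :
    ∃ (Ω : Type) (_ : Field Ω) (_ : IsAlgClosed Ω) (i : L →+* Ω) (j : K →+* Ω),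
      i.comp b = j.comp a := by
  let := a.toAlgebra
  let := b.toAlgebra
  obtain ⟨M, hM⟩ := Ideal.exists_maximal (K ⊗[E] L)
  let := Ideal.Quotient.field M
  let q := (algebraMap (K ⊗[E] L ⧸ M) (AlgebraicClosure (K ⊗[E] L ⧸ M))).comp (Ideal.Quotient.mk M)
  refine ⟨AlgebraicClosure (K ⊗[E] L ⧸ M), inferInstance, inferInstance,
    q.comp (Algebra.TensorProduct.includeRight : L →ₐ[E] K ⊗[E] L).toRingHom,
    q.comp (Algebra.TensorProduct.includeLeft : K →ₐ[E] K ⊗[E] L).toRingHom, ?_⟩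
  ext x
  have h1 := (Algebra.TensorProduct.includeRight : L →ₐ[E] K ⊗[E] L).commutes x
  have h2 := (Algebra.TensorProduct.includeLeft : K →ₐ[E] K ⊗[E] L).commutes x
  exact congrArg q (h1.trans h2.symm)

theorem two_emb {k K : Type} [Field k] [Field K] [Algebra k K] [CharZero k] (F : K)
    (hF : F ∉ Set.range (algebraMap k K)) :
    ∃ (Ω : Type) (_ : Field Ω) (_ : IsAlgClosed Ω) (j1 j2 : K →+* Ω),
      (∀ c : k, j1 (algebraMap k K c) = j2 (algebraMap k K c)) ∧ j1 F ≠ j2 F := by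
  let E := IntermediateField.adjoin k {F}
  have hs : ¬ Subsingleton (Field.Emb k E) := by
    intro h
    have hp := (isPurelyInseparable_iff_subsingleton_emb k E).2 h
    have := hp.isIntegral
    have : Algebra.IsAlgebraic k E := inferInstance
    obtain ⟨y, hy⟩ := IsPurelyInseparable.surjective_algebraMap_of_isSeparable k E
      (⟨F, IntermediateField.mem_adjoin_simple_self k F⟩ : E)
    exact hF ⟨y, congrArg (algebraMap E K) hy⟩
  rw [not_subsingleton_iff_nontrivial] at hs
  obtain ⟨s1, s2, hne⟩ := hs
  have hne' : s1 (IntermediateField.AdjoinSimple.gen k F) ≠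
      s2 (IntermediateField.AdjoinSimple.gen k F) := by
    intro h
    apply hne
    exact IntermediateField.algHom_ext_of_eq_adjoin k (rfl : E = IntermediateField.adjoin k {F}) (by
      intro x hx
      obtain rfl : x = F := hx
      exact h)
  obtain ⟨Ω1, _, _, i1, j1, h1⟩ := amalg (algebraMap E K) s1.toRingHom
  obtain ⟨Ω2, _, _, i2, j2, h2⟩ := amalg (algebraMap E K) (i1.comp s2.toRingHom)
  have e1 : ∀ x : E, i2 (j1 x.1) = i2 (i1 (s1 x)) := fun x =>
    congrArg i2 (DFunLike.congr_fun h1 x).symm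
  have e2 : ∀ x : E, j2 x.1 = i2 (i1 (s2 x)) := fun x => (DFunLike.congr_fun h2 x).symm
  refine ⟨Ω2, inferInstance, inferInstance, i2.comp j1, j2, fun c => ?_, ?_⟩
  · have a1 := e1 (algebraMap k E c)
    have a2 := e2 (algebraMap k E c)
    rw [s1.commutes] at a1
    rw [s2.commutes] at a2
    exact a1.trans a2.symm
  · have a1 := e1 (IntermediateField.AdjoinSimple.gen k F)
    have a2 := e2 (IntermediateField.AdjoinSimple.gen k F)
    intro h
    apply hne'
    apply i1.injective
    apply i2.injective
    rw [← a1, ← a2]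
    exact h

end embs

section surj

def qbad : MvPolynomial (Fin 8) ℂ :=
  X 1 * X 2 * (1 + X 0) * (4 * X 1 + (2 * X 0 + 1) ^ 2) *
  ((4 - 2 * X 2) * 4 * X 1 * (1 + X 0) - X 2 * ((2 * X 0 + 1) ^ 2 - 4 * X 1 * (2 * X 0 + 1))) *
  (X 2 * X 3 - X 5 ^ 2) *
  ((X 1 * X 2 * X 4 - X 7 ^ 2) * (X 2 * X 3 - X 5 ^ 2) - (X 6 * X 2 - X 5 * X 7) ^ 2)

theorem qbad_ne : qbad ≠ 0 := by
  intro h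
  have := congrArg (eval ![0, 1, 1, 1, 1, 0, 0, 0]) h
  simp [qbad] at this
  norm_num at this

theorem qsurj (z : Fin 8 → ℂ) (hz : eval z qbad ≠ 0) :
    ∃ x : Fin 3 × Fin 5 → ℂ, qnd (qL x) ≠ 0 ∧
      ∀ i, qden (qL x) i ≠ 0 ∧ qnum (qL x) i / qden (qL x) i = z i := by
  have c2 : eval z (2 : MvPolynomial (Fin 8) ℂ) = 2 := map_ofNat _ 2
  have c4 : eval z (4 : MvPolynomial (Fin 8) ℂ) = 4 := map_ofNat _ 4
  simp only [qbad, map_mul, map_add, map_sub, map_pow, eval_X, c2, c4, map_one, mul_ne_zero_iff]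
    at hz
  obtain ⟨⟨⟨⟨⟨⟨h1, h2⟩, h3⟩, h4⟩, h5⟩, h6⟩, h7⟩ := hz
  have sq : ∀ a : ℂ, ∃ b, b ^ 2 = a := fun a => IsAlgClosed.exists_pow_nat_eq a (by norm_num)
  obtain ⟨l1, hl1⟩ := sq (z 1)
  obtain ⟨n2, hn2⟩ := sq (z 2)
  have l0 : l1 ≠ 0 := by rintro rfl; apply h1; rw [← hl1]; simp
  have n0 : n2 ≠ 0 := by rintro rfl; apply h2; rw [← hn2]; simp
  set n1 := z 0 with hn1
  obtain ⟨n3, hn3⟩ : ∃ n3, n3 = -(2 * n1 + 1) * n2 / (2 * l1) := ⟨_, rfl⟩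
  obtain ⟨l2, hl2⟩ : ∃ l2, l2 = (n3 + 2 * l1 * n2) / (2 * (1 + n1)) := ⟨_, rfl⟩
  obtain ⟨a, ha⟩ : ∃ a, a = z 5 / n2 := ⟨_, rfl⟩
  obtain ⟨b, hb⟩ : ∃ b, b = z 7 / (l1 * n2) := ⟨_, rfl⟩
  obtain ⟨c, hc⟩ := sq (z 3 - a ^ 2)
  have c0 : c ≠ 0 := by
    rintro rfl
    apply h6
    have : z 3 = a ^ 2 := by linear_combination -hc
    rw [this, ha, ← hn2]
    field_simp
    ring
  obtain ⟨d, hd⟩ : ∃ d, d = (z 6 / l1 - a * b) / c := ⟨_, rfl⟩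
  obtain ⟨e, he⟩ := sq (z 4 - b ^ 2 - d ^ 2)
  have e0 : e ≠ 0 := by
    rintro rfl
    apply h7
    have e1 : z 4 = b ^ 2 + d ^ 2 := by linear_combination -he
    have e2 : z 3 = c ^ 2 + a ^ 2 := by linear_combination -hc
    have e3 : z 5 = a * n2 := by rw [ha]; field_simp
    have e4 : z 7 = b * l1 * n2 := by rw [hb]; field_simp
    have e5 : z 6 = (c * d + a * b) * l1 := by rw [hd]; field_simp; ring
    rw [e1, e2, e3, e4, e5, ← hl1, ← hn2]
    ring
  have g1 : 2 * l1 * n3 + (2 * n1 + 1) * n2 = 0 := by rw [hn3]; field_simp; ring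
  have g2 : 2 * (1 + n1) * l2 = n3 + 2 * l1 * n2 := by rw [hl2]; field_simp
  have hg : qgood n1 n2 n3 l1 l2 := ⟨g1, g2⟩
  let C : M3 ℂ := !![1, a, b; 0, c, d; 0, 0, e]
  have k1 : l2 - n3 ≠ 0 := by
    intro h
    apply h4
    have h' : l2 = n3 := by linear_combination h
    rw [h'] at g2
    apply mul_left_cancel₀ n0
    rw [← hl1]
    linear_combination (-2 * l1) * g2 + (2 * n1 + 1) * g1
  have k2 : qkap n2 n3 l2 ≠ 0 := by
    intro h
    apply h5
    rw [qkap] at h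
    rw [← hl1, ← hn2]
    have e1 : (2 * n1 + 1) * n2 = - (2 * l1 * n3) := by linear_combination g1
    linear_combination (4 * l1 ^ 2 * (1 + n1)) * h + 4 * l1 ^ 2 * n3 * g2 + (4 * l1 ^ 2 * n2 - (2 * n1 + 1) * n2 + 2 * l1 * n3) * g1
  have hN00 : (C.transpose * C) 0 0 = 1 := by
    simp [C, Matrix.mul_apply, Fin.sum_univ_three]
  have hN01 : (C.transpose * C) 0 1 = a := by
    simp [C, Matrix.mul_apply, Fin.sum_univ_three]
  have hN02 : (C.transpose * C) 0 2 = b := by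
    simp [C, Matrix.mul_apply, Fin.sum_univ_three]
  have hN11 : (C.transpose * C) 1 1 = z 3 := by
    simp [C, Matrix.mul_apply, Fin.sum_univ_three]; linear_combination hc
  have hN12 : (C.transpose * C) 1 2 = z 6 / l1 := by
    simp [C, Matrix.mul_apply, Fin.sum_univ_three]; rw [hd]; field_simp; ring
  have hN22 : (C.transpose * C) 2 2 = z 4 := by
    simp [C, Matrix.mul_apply, Fin.sum_univ_three]; linear_combination he
  obtain ⟨x, hx⟩ := qL_surj (qmix C (qt n1 n2 n3 l1 l2)) (qsym_mix _ _ (qsym_t _ _ _ _ _))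
    (qmix_trace _ _ (by
      intro i
      fin_cases i <;> simp [qt, qt6, Matrix.trace, Fin.sum_univ_three]))
  have hnd : qnd (qL x) ≠ 0 := by
    rw [hx, qnd_slice C hg]
    refine ⟨?_, k2, k1, l0, n0, h3, ?_⟩
    · simp [C, Matrix.det_fin_three, c0, e0]
    · rw [hN00]; exact one_ne_zero
  refine ⟨x, hnd, fun i => ?_⟩
  rw [hx] at hnd
  obtain ⟨y1, y2⟩ := qy_slice C hg hnd i
  rw [hx]
  refine ⟨y1, y2.trans ?_⟩
  rw [hN00, hN01, hN02, hN11, hN12, hN22]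
  fin_cases i
  · simp [hn1]
  · simp [hl1]
  · simp [hn2]
  · simp
  · simp
  · simp [ha]; field_simp
  · simp; field_simp
  · simp [hb]; field_simp

end surj

section main

abbrev qR := MvPolynomial (Fin 3 × Fin 5) ℂ
abbrev qK := FractionRing qR

def qXR : Fin 3 × Fin 5 → qR := X

def qy (i : Fin 8) : qK :=
  algebraMap qR qK (qnum (qL qXR) i) / algebraMap qR qK (qden (qL qXR) i)

/-- evaluation at a point -/
theorem qev {k : Type*} [CommRing k] [Algebra ℂ k] (x : Fin 3 × Fin 5 → k) :
    qL x = qmap (aeval x : qR →ₐ[ℂ] k).toRingHom (qL qXR) := by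
  rw [← qL_map]
  congr 1
  funext p
  simp [qXR]

theorem qev_num {k : Type*} [CommRing k] [Algebra ℂ k] (x : Fin 3 × Fin 5 → k) (i : Fin 8) :
    qnum (qL x) i = aeval x (qnum (qL qXR) i) := by rw [qev, qnum_map]; rfl

theorem qev_den {k : Type*} [CommRing k] [Algebra ℂ k] (x : Fin 3 × Fin 5 → k) (i : Fin 8) :
    qden (qL x) i = aeval x (qden (qL qXR) i) := by rw [qev, qden_map]; rfl

theorem qev_nd {k : Type*} [CommRing k] [Algebra ℂ k] (x : Fin 3 × Fin 5 → k) :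
    qnd (qL x) = aeval x (qnd (qL qXR)) := by rw [qev, qnd_map]; rfl

theorem qex : ∃ z : Fin 8 → ℂ, eval z qbad ≠ 0 := by
  by_contra h
  push Not at h
  exact qbad_ne (MvPolynomial.funext fun z => by rw [h z, map_zero])

theorem qnd_X : qnd (qL qXR) ≠ 0 := by
  obtain ⟨z, hz⟩ := qex
  obtain ⟨x, hx, -⟩ := qsurj z hz
  intro h
  rw [qev_nd, h, map_zero] at hx
  exact hx rfl

theorem qden_X (i : Fin 8) : qden (qL qXR) i ≠ 0 := by
  obtain ⟨z, hz⟩ := qex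
  obtain ⟨x, -, hx⟩ := qsurj z hz
  intro h
  have := (hx i).1
  rw [qev_den, h, map_zero] at this
  exact this rfl

theorem qact_X (g h : SL2) (t : ℂˣ) : (coordHomAB 2 4 g h t) ∘ qXR =
    algebraMap ℂ qR t • qact (g.1.map (algebraMap ℂ qR)) (h.1.map (algebraMap ℂ qR)) qXR := by
  funext p
  have := coordHom_eq g h t (X p) qXR
  rw [aeval_X] at this
  rw [← this]
  have e : (aeval qXR : qR →ₐ[ℂ] qR) = AlgHom.id ℂ qR := aeval_X_left
  rw [e]
  rfl

theorem qy_inv (g h : SL2) (t : ℂˣ) (i : Fin 8) :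
    coordHomAB 2 4 g h t (qnum (qL qXR) i) * qden (qL qXR) i =
      coordHomAB 2 4 g h t (qden (qL qXR) i) * qnum (qL qXR) i := by
  have hd : ∀ g : SL2, (g.1.map (algebraMap ℂ qR)).det = 1 := by
    intro g
    have := (algebraMap ℂ qR).map_det g.1
    rw [g.2, map_one] at this
    exact this.symm
  have e := qL_map (coordHomAB 2 4 g h t) qXR
  rw [qact_X, qL_smul, qL_act, qmix_mul] at e
  have e1 : coordHomAB 2 4 g h t (qnum (qL qXR) i) =
      qnum (qmap (coordHomAB 2 4 g h t).toRingHom (qL qXR)) i := by rw [qnum_map]; rfl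
  have e2 : coordHomAB 2 4 g h t (qden (qL qXR) i) =
      qden (qmap (coordHomAB 2 4 g h t).toRingHom (qL qXR)) i := by rw [qden_map]; rfl
  rw [e1, e2, ← e, ← qconj_mix, qnum_conj (qO_rot _ (hd h)), qden_conj (qO_rot _ (hd h))]
  apply qinv_mix _ _ (qL_sym _) ((algebraMap ℂ qR t) ^ 2)
  rw [smul_mul_assoc, one_mul, Matrix.transpose_smul, smul_mul_smul_comm, qO_tr, hd]
  simp [pow_two]

theorem qy_mem (i : Fin 8) : qy i ∈ invFieldAB 2 4 :=
  ⟨qnum (qL qXR) i, qden (qL qXR) i, qden_X i, rfl, fun γ => qy_inv γ.1 γ.2.1 γ.2.2 i⟩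

theorem inv_le (F : qK) (hF : F ∈ invFieldAB 2 4) :
    F ∈ IntermediateField.adjoin ℂ (Set.range qy) := by
  by_contra hcon
  obtain ⟨f, g, hg, hfg, hinv⟩ := hF
  obtain ⟨Ω, _, _, j1, j2, hj, hne⟩ := two_emb (k := IntermediateField.adjoin ℂ (Set.range qy)) F (by
    rintro ⟨y, hy⟩
    exact hcon (hy ▸ y.2))
  let := (j1.comp (algebraMap ℂ qK)).toAlgebra
  have hc : ∀ c : ℂ, j2 (algebraMap ℂ qK c) = algebraMap ℂ Ω c := fun c =>
    (hj (algebraMap ℂ _ c)).symm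
  let J1 : qK →ₐ[ℂ] Ω := { j1 with commutes' := fun c => rfl }
  let J2 : qK →ₐ[ℂ] Ω := { j2 with commutes' := hc }
  have hne' : J1 F ≠ J2 F := hne
  have hJy : ∀ i, J1 (qy i) = J2 (qy i) := fun i =>
    hj ⟨qy i, IntermediateField.subset_adjoin _ _ ⟨i, rfl⟩⟩
  clear_value J1 J2
  have key : ∀ (J : qK →ₐ[ℂ] Ω) (p : qR),
      J (algebraMap qR qK p) = aeval (fun v => J (algebraMap qR qK (X v))) p := by
    intro J p
    have : (J.comp (IsScalarTower.toAlgHom ℂ qR qK)) =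
      aeval (fun v => J (algebraMap qR qK (X v))) := by
      apply algHom_ext
      intro v
      simp
    exact DFunLike.congr_fun this p
  have inj : ∀ (J : qK →ₐ[ℂ] Ω) (p : qR), p ≠ 0 →
      aeval (fun v => J (algebraMap qR qK (X v))) p ≠ 0 := by
    intro J p hp h
    rw [← key, map_eq_zero] at h
    exact hp ((map_eq_zero_iff _ (IsFractionRing.injective qR qK)).1 h)
  have hy : ∀ i, qnum (qL (fun v => J1 (algebraMap qR qK (X v)))) i /
        qden (qL (fun v => J1 (algebraMap qR qK (X v)))) i =
      qnum (qL (fun v => J2 (algebraMap qR qK (X v)))) i /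
        qden (qL (fun v => J2 (algebraMap qR qK (X v)))) i := by
    intro i
    have := hJy i
    rw [qy, map_div₀, map_div₀, key, key, key, key] at this
    rw [qev_num, qev_den, qev_num (fun v => J2 (algebraMap qR qK (X v))),
      qev_den (fun v => J2 (algebraMap qR qK (X v)))]
    exact this
  obtain ⟨a, b, hab⟩ := qorbit_x _ _ (by rw [qev_nd]; exact inj _ _ qnd_X)
    (by rw [qev_nd]; exact inj _ _ qnd_X) hy
  have hd := dens f g hinv a b (fun v => J1 (algebraMap qR qK (X v)))
  rw [← hab] at hd
  apply hne'
  rw [hfg, map_div₀, map_div₀, key, key, key, key, div_eq_div_iff (inj _ _ hg) (inj _ _ hg)]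
  linear_combination -hd

theorem qy_indep : AlgebraicIndependent ℂ qy := by
  rw [algebraicIndependent_iff]
  intro P hP
  -- localise
  let D : qR := ∏ i, qden (qL qXR) i
  have main : ∀ z : Fin 8 → ℂ, eval z qbad ≠ 0 → eval z P = 0 := by
    intro z hz
    obtain ⟨x, -, hx⟩ := qsurj z hz
    let M : Submonoid qR := (nonZeroDivisors ℂ).comap (aeval x : qR →ₐ[ℂ] ℂ)
    have hM : M ≤ nonZeroDivisors qR := by
      intro m hm
      rw [mem_nonZeroDivisors_iff_ne_zero]
      rintro rfl
      have h0 : (aeval x (0 : qR) : ℂ) ∈ nonZeroDivisors ℂ := hm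
      rw [map_zero] at h0
      exact (mem_nonZeroDivisors_iff_ne_zero.1 h0) rfl
    let ψ : Localization M →ₐ[ℂ] ℂ := IsLocalization.liftAlgHom (M := M) (f := aeval x) (by
      intro m
      exact isUnit_iff_ne_zero.2 (mem_nonZeroDivisors_iff_ne_zero.1 m.2))
    let ι : Localization M →ₐ[ℂ] qK := IsLocalization.liftAlgHom (M := M)
      (f := IsScalarTower.toAlgHom ℂ qR qK) (by
      intro m
      exact IsLocalization.map_units qK (⟨m.1, hM m.2⟩ : nonZeroDivisors qR))
    have hι : Function.Injective ι := by
      have : Function.Injective (IsLocalization.lift (M := M) (S := Localization M)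
          (g := algebraMap qR qK) (fun m =>
            IsLocalization.map_units qK (⟨m.1, hM m.2⟩ : nonZeroDivisors qR))) := by
        rw [IsLocalization.lift_injective_iff]
        intro a b
        rw [(IsLocalization.injective (Localization M) hM).eq_iff,
          (IsFractionRing.injective qR qK).eq_iff]
      exact this
    have hden : ∀ i, qden (qL qXR) i ∈ M := fun i => by
      have := (hx i).1
      rw [qev_den] at this
      exact mem_nonZeroDivisors_iff_ne_zero.2 this
    let w : Fin 8 → Localization M := fun i =>
      IsLocalization.mk' (Localization M) (qnum (qL qXR) i) ⟨qden (qL qXR) i, hden i⟩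
    have hw : ∀ i, w i * algebraMap qR (Localization M) (qden (qL qXR) i) =
        algebraMap qR (Localization M) (qnum (qL qXR) i) := fun i =>
      IsLocalization.mk'_spec (Localization M) (qnum (qL qXR) i) ⟨qden (qL qXR) i, hden i⟩
    have hιa : ∀ r, ι (algebraMap qR (Localization M) r) = algebraMap qR qK r := fun r =>
      IsLocalization.lift_eq _ _
    have hψa : ∀ r, ψ (algebraMap qR (Localization M) r) = aeval x r := fun r =>
      IsLocalization.lift_eq _ _
    have h1 : ∀ i, ι (w i) = qy i := by
      intro i
      have := congrArg ι (hw i)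
      rw [map_mul, hιa, hιa] at this
      rw [qy, eq_div_iff, this]
      exact fun h => qden_X i ((map_eq_zero_iff _ (IsFractionRing.injective qR qK)).1 h)
    have h2 : ∀ i, ψ (w i) = z i := by
      intro i
      have := congrArg ψ (hw i)
      rw [map_mul, hψa, hψa] at this
      rw [← (hx i).2, qev_num, qev_den, eq_div_iff, this]
      rw [← qev_den]
      exact (hx i).1
    have h3 : ι (aeval w P) = 0 := by
      rw [← AlgHom.comp_apply, comp_aeval]
      simp only [h1]
      exact hP
    have h4 : aeval w P = 0 := hι (by rw [h3, map_zero])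
    have h5 := congrArg ψ h4
    rw [← AlgHom.comp_apply, comp_aeval, map_zero] at h5
    simp only [h2] at h5
    exact h5
  have : P * qbad = 0 := by
    apply MvPolynomial.funext
    intro z
    rw [map_mul, map_zero]
    by_cases h : eval z qbad = 0
    · rw [h, mul_zero]
    · rw [main z h, zero_mul]
  exact (mul_eq_zero.1 this).resolve_right qbad_ne

theorem inv_eq : invFieldAB 2 4 = IntermediateField.adjoin ℂ (Set.range qy) := by
  apply le_antisymm
  · intro F hF
    exact inv_le F hF
  · rw [IntermediateField.adjoin_le_iff]
    rintro _ ⟨i, rfl⟩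
    exact qy_mem i

theorem qfinal : Nonempty ((invFieldAB 2 4) ≃ₐ[ℂ] FractionRing (MvPolynomial (Fin 8) ℂ)) :=
  ⟨(IntermediateField.equivOfEq inv_eq).trans qy_indep.aevalEquivField.symm⟩

end main
/-- **Rationality of `P(V_{2,4}) / (SL₂(ℂ) × SL₂(ℂ))`**: the field of invariant rational
functions is purely transcendental over `ℂ` of transcendence degree 8. -/
theorem quotient_rational_2_4 :
    Nonempty ((invFieldAB 2 4) ≃ₐ[ℂ] FractionRing (MvPolynomial (Fin 8) ℂ)) := by
  exact qfinal
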